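/- arXiv:1711.01614 — 2 statements merged into one kernel-verified Lean document; each statement's English description precedes it below -/
import Mathlib

section
/- For every integer n ≥ 4, every planar simple graph G on n vertices that contains no member of Θ₄ as a subgraph (equivalently, no subgraph isomorphic to K₄ minus an edge) satisfies e(G) ≤ 12(n−2)/5. In particular, the planar Turán number satisfies ex_P(n, Θ₄) ≤ 12(n−2)/5 for all n ≥ 4. -/
open SimpleGraph

/-- `G` has a planar embedding (drawing in the plane): vertices are mapped to distinct
points of `ℝ²`, each edge `uv` is drawn as a simple continuous arc from the point of `u`
to the point of `v`, arcs traversed in opposite directions coincide, the interior of an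
arc passes through no vertex point, and the interiors of arcs of distinct edges are
disjoint. -/
def SimpleGraph.HasPlanarEmbedding {V : Type*} (G : SimpleGraph V) : Prop :=
  ∃ (pos : V → ℝ × ℝ) (arc : V → V → ℝ → ℝ × ℝ),
    Function.Injective pos ∧
    (∀ u v : V, G.Adj u v →
      ContinuousOn (arc u v) (Set.Icc (0 : ℝ) 1) ∧
      Set.InjOn (arc u v) (Set.Icc (0 : ℝ) 1) ∧
      arc u v 0 = pos u ∧
      arc u v 1 = pos v ∧
      (∀ t : ℝ, arc u v t = arc v u (1 - t)) ∧
      (∀ w : V, ∀ t ∈ Set.Ioo (0 : ℝ) 1, arc u v t ≠ pos w)) ∧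
    (∀ u v x y : V, G.Adj u v → G.Adj x y → s(u, v) ≠ s(x, y) →
      ∀ t₁ ∈ Set.Ioo (0 : ℝ) 1, ∀ t₂ ∈ Set.Ioo (0 : ℝ) 1, arc u v t₁ ≠ arc x y t₂)

/-- `G` contains a subgraph isomorphic to `F`, i.e. there is an injective graph
homomorphism from `F` to `G`. -/
def ContainsCopy {α β : Type*} (F : SimpleGraph α) (G : SimpleGraph β) : Prop :=
  ∃ f : F →g G, Function.Injective f

/-- The Theta graph on 4 vertices: the 4-cycle 0-1-2-3-0 plus the chord 02,
i.e. `K₄` minus one edge. -/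
def theta4 : SimpleGraph (Fin 4) :=
  SimpleGraph.fromEdgeSet {s(0, 1), s(1, 2), s(2, 3), s(0, 3), s(0, 2)}

/-- The Theta graph on 5 vertices: the 5-cycle 0-1-2-3-4-0 plus the chord 02. -/
def theta5 : SimpleGraph (Fin 5) :=
  SimpleGraph.fromEdgeSet {s(0, 1), s(1, 2), s(2, 3), s(3, 4), s(0, 4), s(0, 2)}

/-- The cycle on 6 vertices: 0-1-2-3-4-5-0. -/
def cycle6 : SimpleGraph (Fin 6) :=
  SimpleGraph.fromEdgeSet {s(0, 1), s(1, 2), s(2, 3), s(3, 4), s(4, 5), s(0, 5)}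

/-- `G` contains no member of `Θ₆` as a subgraph: for each pair of distinct
non-consecutive vertices `a`, `b` of the 6-cycle, `G` contains no copy of the Theta
graph obtained from the 6-cycle by adding the chord `ab`. -/
def Theta6Free {β : Type*} (G : SimpleGraph β) : Prop :=
  ∀ a b : Fin 6, a ≠ b → ¬ cycle6.Adj a b →
    ¬ ContainsCopy (cycle6 ⊔ SimpleGraph.fromEdgeSet {s(a, b)}) G

/-- `K₅⁻`: the complete graph on 5 vertices minus one edge. -/
def K5minus : SimpleGraph (Fin 5) :=
  (⊤ : SimpleGraph (Fin 5)).deleteEdges {s(0, 1)}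

open Topology

namespace PlanarTuran

/-! ### The square grid and its mod 2 chains -/

/-- Edges of the square grid on `ℤ × ℤ`: `(false, p)` joins `p` to `p + (1, 0)` and
`(true, p)` joins `p` to `p + (0, 1)`. -/
abbrev GridEdge := Bool × ℤ × ℤ

/-- The second end of a grid edge; the first end of `e` is `e.2`. -/
def GridEdge.tgt (e : GridEdge) : ℤ × ℤ :=
  if e.1 then (e.2.1, e.2.2 + 1) else (e.2.1 + 1, e.2.2)

/-- Unit squares are indexed by their lower left corner. One of the two squares at `e` is
`e.2`, and this is the other one. -/
def GridEdge.opp (e : GridEdge) : ℤ × ℤ :=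
  if e.1 then (e.2.1 - 1, e.2.2) else (e.2.1, e.2.2 - 1)

/-- The mod 2 boundary of a finite chain of grid edges. -/
noncomputable def boundary : (GridEdge →₀ ZMod 2) →ₗ[ZMod 2] (ℤ × ℤ →₀ ZMod 2) :=
  Finsupp.linearCombination (ZMod 2) fun e => Finsupp.single e.2 1 + Finsupp.single e.tgt 1

@[simp] lemma boundary_single (e : GridEdge) :
    boundary (Finsupp.single e 1) = Finsupp.single e.2 1 + Finsupp.single e.tgt 1 := by
  simp [boundary]

/-- Every finite mod 2 cycle in the grid is the boundary of a set of squares. -/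
lemma exists_potential (z : GridEdge →₀ ZMod 2) (hz : boundary z = 0) :
    ∃ c : ℤ × ℤ → ZMod 2, ∀ e, z e = c e.2 + c e.opp := by
  let above : ℤ × ℤ → (GridEdge →₀ ZMod 2) →ₗ[ZMod 2] ZMod 2 := fun p =>
    Finsupp.linearCombination (ZMod 2) fun e =>
      if e.1 = false ∧ e.2.1 = p.1 ∧ p.2 < e.2.2 then 1 else 0
  let column : ℤ × ℤ → (ℤ × ℤ →₀ ZMod 2) →ₗ[ZMod 2] ZMod 2 := fun p =>
    Finsupp.linearCombination (ZMod 2) fun q => if q.1 = p.1 ∧ p.2 < q.2 then 1 else 0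
  have key : ∀ e : GridEdge, Finsupp.lapply e + (above e.2 + above e.opp) =
      if e.1 then column e.2 ∘ₗ boundary else 0 := by
    rintro ⟨b, i, j⟩
    refine Finsupp.lhom_ext' fun ⟨b', i', j'⟩ => LinearMap.ext_ring ?_
    cases b <;> cases b' <;>
      simp [above, column, GridEdge.opp, GridEdge.tgt, Finsupp.single_apply] <;>
      split_ifs <;> first | rfl | omega
  refine ⟨fun p => above p z, fun e => ?_⟩
  have h := LinearMap.congr_fun (key e) z
  have h0 : z e + (above e.2 z + above e.opp z) = 0 := by
    cases hb : e.1 <;> simpa [hb, hz] using h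
  exact (CharTwo.add_eq_zero).mp h0

/-- The four grid edges at a vertex. -/
noncomputable def star (p : ℤ × ℤ) : GridEdge →₀ ZMod 2 :=
  Finsupp.single (false, p) 1 + Finsupp.single (false, p.1 - 1, p.2) 1 +
    (Finsupp.single (true, p) 1 + Finsupp.single (true, p.1, p.2 - 1) 1)

lemma star_apply (p : ℤ × ℤ) (e : GridEdge) :
    star p e = (if e.2 = p then 1 else 0) + (if e.tgt = p then 1 else 0) := by
  obtain ⟨b, i, j⟩ := e
  obtain ⟨k, l⟩ := p
  cases b <;> simp [star, GridEdge.tgt, Finsupp.single_apply] <;>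
    split_ifs <;> first | rfl | omega

/-- Around a vertex the jumps of a function on squares add up to zero. -/
lemma linearCombination_star (c : ℤ × ℤ → ZMod 2) (p : ℤ × ℤ) :
    Finsupp.linearCombination (ZMod 2) (fun e : GridEdge => c e.2 + c e.opp) (star p) = 0 := by
  have h2 : ∀ x : ZMod 2, x + x = 0 := CharTwo.add_self_eq_zero
  simp only [star, map_add, Finsupp.linearCombination_single, GridEdge.opp]
  simp only [one_smul, if_true, Bool.false_eq_true, if_false]
  linear_combination h2 (c p) + h2 (c (p.1, p.2 - 1)) + h2 (c (p.1 - 1, p.2)) +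
    h2 (c (p.1 - 1, p.2 - 1))

/-- Adjacency in the grid. -/
def GridAdj (p q : ℤ × ℤ) : Prop :=
  ∃ e : GridEdge, (e.2 = p ∧ e.tgt = q) ∨ (e.2 = q ∧ e.tgt = p)

/-- `p` and `q` are joined by a grid path inside `B`. -/
def Linked (B : Set (ℤ × ℤ)) : ℤ × ℤ → ℤ × ℤ → Prop :=
  Relation.ReflTransGen fun p q => GridAdj p q ∧ p ∈ B ∧ q ∈ B

lemma GridAdj.symm {p q : ℤ × ℤ} (h : GridAdj p q) : GridAdj q p :=
  let ⟨e, he⟩ := h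
  ⟨e, he.symm⟩

lemma Linked.symm {B : Set (ℤ × ℤ)} {p q : ℤ × ℤ} (h : Linked B p q) : Linked B q p :=
  have : Std.Symm fun p q => GridAdj p q ∧ p ∈ B ∧ q ∈ B :=
    ⟨fun _ _ h => ⟨h.1.symm, h.2.2, h.2.1⟩⟩
  Relation.ReflTransGen.stdSymm.symm _ _ h

lemma Linked.mono {B C : Set (ℤ × ℤ)} (hBC : B ⊆ C) {p q : ℤ × ℤ} (h : Linked B p q) :
    Linked C p q :=
  Relation.ReflTransGen.mono (fun _ _ h => ⟨h.1, hBC h.2.1, hBC h.2.2⟩) _ _ h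

/-- Linked vertices bound a chain of edges inside the set. -/
lemma Linked.exists_chain {B : Set (ℤ × ℤ)} {p q : ℤ × ℤ} (h : Linked B p q) :
    ∃ z : GridEdge →₀ ZMod 2, boundary z = Finsupp.single p 1 + Finsupp.single q 1 ∧
      ∀ e, z e ≠ 0 → e.2 ∈ B ∧ e.tgt ∈ B := by
  have h2 : ∀ x : ℤ × ℤ →₀ ZMod 2, x + x = 0 := fun x => by
    ext; simp [CharTwo.add_self_eq_zero]
  induction h with
  | refl => exact ⟨0, by simp [h2], by simp⟩
  | @tail q r _ hqr ih =>
    obtain ⟨z, hz, hzB⟩ := ih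
    obtain ⟨⟨e, he⟩, hq, hr⟩ := hqr
    refine ⟨z + Finsupp.single e 1, ?_, fun f hf => ?_⟩
    · rw [map_add, hz, boundary_single]
      rcases he with ⟨rfl, rfl⟩ | ⟨rfl, rfl⟩
      · linear_combination (norm := module) h2 (Finsupp.single e.2 1)
      · linear_combination (norm := module) h2 (Finsupp.single e.tgt 1)
    · by_cases hfe : e = f
      · subst hfe
        rcases he with ⟨rfl, rfl⟩ | ⟨rfl, rfl⟩
        exacts [⟨hq, hr⟩, ⟨hr, hq⟩]
      · exact hzB f (by simpa [Finsupp.single_apply, hfe] using hf)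

/-- A grid path into `C` starting outside `C` has a first edge that enters `C`. -/
lemma Linked.exists_entry {B C : Set (ℤ × ℤ)} {p q : ℤ × ℤ} (h : Linked B p q)
    (hp : p ∉ C) (hq : q ∈ C) :
    ∃ x y, Linked (B \ C) p x ∧ x ∉ C ∧ y ∈ C ∧ GridAdj x y := by
  have : (Linked (B \ C) p q ∧ q ∉ C) ∨
      ∃ x y, Linked (B \ C) p x ∧ x ∉ C ∧ y ∈ C ∧ GridAdj x y := by
    clear hq
    induction h with
    | refl => exact Or.inl ⟨.refl, hp⟩
    | @tail q r _ hqr ih =>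
      rcases ih with ⟨ih, hq⟩ | ih
      · by_cases hr : r ∈ C
        · exact Or.inr ⟨q, r, ih, hq, hr, hqr.1⟩
        · exact Or.inl ⟨ih.tail ⟨hqr.1, ⟨hqr.2.1, hq⟩, ⟨hqr.2.2, hr⟩⟩, hr⟩
      · exact Or.inr ih
  exact this.resolve_left fun h => h.2 hq

/-! ### Cycle spaces and duals -/

section Dual

variable {ι V : Type*}

/-- A model of the multigraph `u, w` as a minor of the grid: disjoint linked branch sets,
one for each vertex, and a grid edge between the branch sets of the ends of each edge. -/
structure GridModel (u w : ι → V) where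
  branch : V → Finset (ℤ × ℤ)
  link : ι → GridEdge
  root : V → ℤ × ℤ
  root_mem : ∀ v, root v ∈ branch v
  disjoint : ∀ v v' p, p ∈ branch v → p ∈ branch v' → v = v'
  linked : ∀ v, ∀ p ∈ branch v, ∀ q ∈ branch v, Linked (branch v) p q
  link_mem : ∀ e, ((link e).2 ∈ branch (u e) ∧ (link e).tgt ∈ branch (w e)) ∨
    ((link e).2 ∈ branch (w e) ∧ (link e).tgt ∈ branch (u e))

variable {u w : ι → V}

open Classical in
/-- The mod 2 cycle space of the multigraph with edge set `ι` in which `e` joins `u e`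
and `w e`. -/
def cycleSpace [Fintype ι] (u w : ι → V) : Submodule (ZMod 2) (ι → ZMod 2) where
  carrier := {y | ∀ v, ∑ e, y e * ((if u e = v then 1 else 0) + (if w e = v then 1 else 0)) = 0}
  zero_mem' := by simp
  add_mem' := fun {y z} hy hz v => by
    simp only [Pi.add_apply, add_mul, Finset.sum_add_distrib, hy v, hz v, add_zero]
  smul_mem' := fun a y hy v => by
    simp only [Pi.smul_apply, smul_eq_mul, mul_assoc, ← Finset.mul_sum, hy v, mul_zero]

namespace GridModel

lemma link_inj (M : GridModel u w) (huw : Function.Injective fun e => s(u e, w e)) :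
    Function.Injective M.link := by
  intro e f h
  apply huw
  have he := M.link_mem e
  have hf := M.link_mem f
  rw [h] at he
  rcases he with he | he <;> rcases hf with hf | hf <;>
    simp [M.disjoint _ _ _ he.1 hf.1, M.disjoint _ _ _ he.2 hf.2]

lemma not_inside (M : GridModel u w) (hne : ∀ e, u e ≠ w e) (e : ι) (v : V) :
    ¬ ((M.link e).2 ∈ M.branch v ∧ (M.link e).tgt ∈ M.branch v) := by
  rintro ⟨h1, h2⟩
  rcases M.link_mem e with h | h
  · exact hne e ((M.disjoint _ _ _ h.1 h1).trans (M.disjoint _ _ _ h2 h.2))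
  · exact hne e ((M.disjoint _ _ _ h.2 h2).trans (M.disjoint _ _ _ h1 h.1))

/-- The grid edges used by the model. -/
def used (M : GridModel u w) : Set GridEdge :=
  {g | (∃ v, g.2 ∈ M.branch v ∧ g.tgt ∈ M.branch v) ∨ g ∈ Set.range M.link}

open Classical in
/-- Every edge extends to a chain of used edges between the roots of its ends. -/
lemma exists_edge_chain (M : GridModel u w) (hne : ∀ e, u e ≠ w e)
    (huw : Function.Injective fun e => s(u e, w e)) (e : ι) :
    ∃ z : GridEdge →₀ ZMod 2,
      boundary z = Finsupp.single (M.root (u e)) 1 + Finsupp.single (M.root (w e)) 1 ∧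
      (∀ f, z (M.link f) = if f = e then 1 else 0) ∧ ∀ g ∉ M.used, z g = 0 := by
  have main : ∀ a b, a ∈ M.branch (u e) → b ∈ M.branch (w e) →
      boundary (Finsupp.single (M.link e) 1) = Finsupp.single a 1 + Finsupp.single b 1 →
      ∃ z : GridEdge →₀ ZMod 2,
        boundary z = Finsupp.single (M.root (u e)) 1 + Finsupp.single (M.root (w e)) 1 ∧
        (∀ f, z (M.link f) = if f = e then 1 else 0) ∧ ∀ g ∉ M.used, z g = 0 := by
    intro a b ha hb hab
    have h2 : ∀ x : ℤ × ℤ →₀ ZMod 2, x + x = 0 := fun x => by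
      ext; simp [CharTwo.add_self_eq_zero]
    obtain ⟨z₁, hz₁, hz₁'⟩ := (M.linked _ _ (M.root_mem (u e)) _ ha).exists_chain
    obtain ⟨z₂, hz₂, hz₂'⟩ := (M.linked _ _ hb _ (M.root_mem (w e))).exists_chain
    refine ⟨z₁ + Finsupp.single (M.link e) 1 + z₂, ?_, fun f => ?_, fun g hg => ?_⟩
    · rw [map_add, map_add, hz₁, hz₂, hab]
      linear_combination (norm := module) h2 (Finsupp.single a 1) + h2 (Finsupp.single b 1)
    · have e₁ : z₁ (M.link f) = 0 := by
        by_contra h; exact M.not_inside hne f _ (hz₁' _ h)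
      have e₂ : z₂ (M.link f) = 0 := by
        by_contra h; exact M.not_inside hne f _ (hz₂' _ h)
      simp [e₁, e₂, Finsupp.single_apply, (M.link_inj huw).eq_iff, eq_comm]
    · have e₁ : z₁ g = 0 := by
        by_contra h; exact hg (Or.inl ⟨_, hz₁' _ h⟩)
      have e₂ : z₂ g = 0 := by
        by_contra h; exact hg (Or.inl ⟨_, hz₂' _ h⟩)
      have e₃ : M.link e ≠ g := fun h => hg (Or.inr ⟨e, h⟩)
      simp [e₁, e₂, e₃]
  rcases M.link_mem e with h | h
  · exact main _ _ h.1 h.2 (boundary_single _)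
  · exact main _ _ h.2 h.1 ((boundary_single _).trans (add_comm _ _))

variable [Fintype ι]

open Classical in
/-- Every cycle of the multigraph is traced by a grid cycle of used edges. -/
lemma exists_cycle_lift (M : GridModel u w) (hne : ∀ e, u e ≠ w e)
    (huw : Function.Injective fun e => s(u e, w e)) {y : ι → ZMod 2}
    (hy : y ∈ cycleSpace u w) :
    ∃ z : GridEdge →₀ ZMod 2, boundary z = 0 ∧ (∀ e, z (M.link e) = y e) ∧
      ∀ g ∉ M.used, z g = 0 := by
  choose P hP hPl hPu using M.exists_edge_chain hne huw
  refine ⟨∑ e, y e • P e, ?_, fun e => ?_, fun g hg => ?_⟩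
  · have hinj : ∀ a b, M.root a = M.root b → a = b := fun a b h =>
      M.disjoint a b _ (M.root_mem a) (h ▸ M.root_mem b)
    simp only [map_sum, map_smul, hP]
    ext p
    simp only [Finsupp.coe_finsetSum, Finset.sum_apply, Finsupp.smul_apply, smul_eq_mul,
      Finsupp.add_apply, Finsupp.single_apply, Finsupp.coe_zero, Pi.zero_apply]
    by_cases hp : ∃ v, M.root v = p
    · obtain ⟨v, rfl⟩ := hp
      have hiff : ∀ a, M.root a = M.root v ↔ a = v := fun a => ⟨hinj a v, fun h => h ▸ rfl⟩
      simpa only [hiff] using hy v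
    · have hne' : ∀ a, M.root a ≠ p := fun a h => hp ⟨a, h⟩
      simp [hne']
  · simp [Finsupp.finsetSum_apply, hPl]
  · simp [Finsupp.finsetSum_apply, hPu _ g hg]

open Classical in
/-- A function on squares that jumps only across used edges has a cycle of jumps. -/
lemma jump_mem_cycleSpace (M : GridModel u w)
    (huw : Function.Injective fun e => s(u e, w e))
    (c : ℤ × ℤ → ZMod 2) (hc : ∀ g ∉ M.used, c g.2 = c g.opp) :
    (fun e => c (M.link e).2 + c (M.link e).opp) ∈ cycleSpace u w := by
  intro v
  let d : GridEdge →₀ ZMod 2 := ∑ p ∈ M.branch v, star p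
  have hd : ∀ g, d g =
      (if g.2 ∈ M.branch v then 1 else 0) + (if g.tgt ∈ M.branch v then 1 else 0) := by
    intro g
    simp [d, Finsupp.finsetSum_apply, star_apply, Finset.sum_add_distrib]
  have h0 : ∑ g ∈ d.support, d g * (c g.2 + c g.opp) = 0 := by
    have : Finsupp.linearCombination (ZMod 2) (fun g : GridEdge => c g.2 + c g.opp) d = 0 := by
      simp [d, map_sum, linearCombination_star]
    simpa [Finsupp.linearCombination_apply, Finsupp.sum] using this
  have hmem : ∀ {p a}, p ∈ M.branch a → (p ∈ M.branch v ↔ a = v) := fun {p a} hp =>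
    ⟨fun h => M.disjoint _ _ _ hp h, fun h => h ▸ hp⟩
  have hinc : ∀ e, d (M.link e) = (if u e = v then 1 else 0) + (if w e = v then 1 else 0) := by
    intro e
    rw [hd]
    rcases M.link_mem e with h | h
    · simp only [hmem h.1, hmem h.2]
    · simp only [hmem h.1, hmem h.2]
      exact add_comm _ _
  refine Eq.trans ?_ h0
  calc _ = ∑ e, d (M.link e) * (c (M.link e).2 + c (M.link e).opp) :=
        Finset.sum_congr rfl fun e _ => by rw [hinc, mul_comm]
    _ = ∑ g ∈ Finset.univ.image M.link, d g * (c g.2 + c g.opp) :=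
        by rw [Finset.sum_image fun a _ b _ h => M.link_inj huw h]
    _ = ∑ g ∈ Finset.univ.image M.link ∪ d.support, d g * (c g.2 + c g.opp) := by
        refine Finset.sum_subset Finset.subset_union_left fun g _ hg => ?_
        by_cases hu : g ∈ M.used
        · rcases hu with ⟨a, ha, hb⟩ | ⟨e, rfl⟩
          · simp only [hd, hmem ha, hmem hb, CharTwo.add_self_eq_zero, zero_mul]
          · exact absurd (Finset.mem_image_of_mem _ (Finset.mem_univ e)) hg
        · rw [hc g hu, CharTwo.add_self_eq_zero, mul_zero]
    _ = _ := by
        refine (Finset.sum_subset Finset.subset_union_right fun g _ hg => ?_).symm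
        rw [Finsupp.notMem_support_iff.mp hg, zero_mul]

open Classical in
/-- A multigraph with a grid model has an algebraic dual: each edge lies between two faces,
and the cycles are exactly the jumps of functions on faces. -/
theorem exists_dual (M : GridModel u w) (hne : ∀ e, u e ≠ w e)
    (huw : Function.Injective fun e => s(u e, w e)) :
    ∃ (Φ : Type) (l r : ι → Φ), ∀ y : ι → ZMod 2,
      y ∈ cycleSpace u w ↔ ∃ c : Φ → ZMod 2, ∀ e, y e = c (l e) + c (r e) := by
  let rel : ℤ × ℤ → ℤ × ℤ → Prop := fun s t => ∃ g ∉ M.used, g.2 = s ∧ g.opp = t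
  refine ⟨Quot rel, fun e => Quot.mk rel (M.link e).2, fun e => Quot.mk rel (M.link e).opp,
    fun y => ⟨fun hy => ?_, ?_⟩⟩
  · obtain ⟨z, hz, hzl, hzu⟩ := M.exists_cycle_lift hne huw hy
    obtain ⟨c, hc⟩ := exists_potential z hz
    refine ⟨Quot.lift c ?_, fun e => (hzl e).symm.trans (hc _)⟩
    rintro _ _ ⟨g, hg, rfl, rfl⟩
    exact CharTwo.add_eq_zero.mp ((hc g).symm.trans (hzu g hg))
  · rintro ⟨c, hc⟩
    have := M.jump_mem_cycleSpace huw (fun p => c (Quot.mk rel p)) fun g hg =>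
      congrArg c (Quot.sound ⟨g, hg, rfl, rfl⟩)
    rwa [funext hc]

end GridModel

end Dual

/-! ### Counting -/

section Counting

variable {ι : Type*} [Fintype ι]

/-- The support of a mod 2 vector. -/
def supp (y : ι → ZMod 2) : Finset ι := {e | y e ≠ 0}

@[simp] lemma mem_supp {y : ι → ZMod 2} {e : ι} : e ∈ supp y ↔ y e ≠ 0 := by simp [supp]

lemma supp_injective : Function.Injective (supp : (ι → ZMod 2) → Finset ι) := by
  intro x y h
  ext e
  have h1 : x e ≠ 0 ↔ y e ≠ 0 := by rw [← mem_supp, h, mem_supp]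
  have h2 : ∀ a b : ZMod 2, (a ≠ 0 ↔ b ≠ 0) → a = b := by decide
  rw [h2 _ _ h1]

lemma supp_nonempty {y : ι → ZMod 2} (hy : y ≠ 0) : (supp y).Nonempty := by
  obtain ⟨e, he⟩ := Function.ne_iff.mp hy
  exact ⟨e, mem_supp.mpr he⟩

lemma sum_card_supp [DecidableEq ι] (J : Finset (ι → ZMod 2)) :
    ∑ y ∈ J, (supp y).card = ∑ e, (J.filter fun y => y e ≠ 0).card := by
  simp_rw [supp, Finset.card_filter]
  exact Finset.sum_comm

/-- A family of sets of size at least three covering every element at most twice, whose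
members of size three are disjoint, is small. -/
lemma card_le_of_double_cover [DecidableEq ι] (J : Finset (ι → ZMod 2))
    (h3 : ∀ y ∈ J, 3 ≤ (supp y).card) (h2 : ∀ e, (J.filter fun y => y e ≠ 0).card ≤ 2)
    (htri : ∀ x ∈ J, ∀ y ∈ J, (supp x).card = 3 → (supp y).card = 3 →
      ∀ e, x e ≠ 0 → y e ≠ 0 → x = y) :
    12 * J.card ≤ 7 * Fintype.card ι := by
  set T := J.filter fun y => (supp y).card = 3
  have hJ : ∑ y ∈ J, (supp y).card ≤ 2 * Fintype.card ι := by
    rw [sum_card_supp]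
    calc _ ≤ ∑ _e : ι, 2 := Finset.sum_le_sum fun e _ => h2 e
      _ = _ := by simp [mul_comm]
  have hT : 3 * T.card ≤ Fintype.card ι := by
    calc 3 * T.card = ∑ y ∈ T, (supp y).card := by
          rw [Finset.sum_congr rfl fun y hy => (Finset.mem_filter.mp hy).2]
          simp [T, mul_comm]
      _ = ∑ e, (T.filter fun y => y e ≠ 0).card := sum_card_supp T
      _ ≤ ∑ _e : ι, 1 := by
          refine Finset.sum_le_sum fun e _ => Finset.card_le_one.mpr fun x hx y hy => ?_
          simp only [T, Finset.mem_filter] at hx hy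
          exact htri x hx.1.1 y hy.1.1 hx.1.2 hy.1.2 e hx.2 hy.2
      _ = _ := by simp
  have hJT : 4 * J.card ≤ ∑ y ∈ J, (supp y).card + T.card := by
    rw [Finset.card_filter, ← Finset.sum_add_distrib, mul_comm, ← smul_eq_mul,
      ← Finset.sum_const]
    refine Finset.sum_le_sum fun y hy => ?_
    have := h3 y hy
    split_ifs <;> omega
  omega

/-- A subspace with a dual contains a double cover of size one more than its dimension. -/
lemma exists_double_cover [DecidableEq ι] (Z : Submodule (ZMod 2) (ι → ZMod 2))
    {Φ : Type*} (l r : ι → Φ)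
    (hZ : ∀ y, y ∈ Z ↔ ∃ c : Φ → ZMod 2, ∀ e, y e = c (l e) + c (r e))
    (hdim : 2 ≤ Module.finrank (ZMod 2) Z) :
    ∃ J : Finset (ι → ZMod 2), J.card = Module.finrank (ZMod 2) Z + 1 ∧
      (∀ y ∈ J, y ∈ Z ∧ y ≠ 0) ∧ ∀ e, (J.filter fun y => y e ≠ 0).card ≤ 2 := by
  classical
  let b : Φ → ι → ZMod 2 := fun φ e =>
    (if l e = φ then 1 else 0) + (if r e = φ then 1 else 0)
  have hb : ∀ φ, b φ ∈ Z := fun φ => (hZ _).mpr ⟨fun ψ => if ψ = φ then 1 else 0, fun _ => rfl⟩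
  have hspan : Submodule.span (ZMod 2) (Set.range b) = Z := by
    refine le_antisymm (Submodule.span_le.mpr (Set.range_subset_iff.mpr hb)) fun y hy => ?_
    obtain ⟨c, hc⟩ := (hZ y).mp hy
    have : y = ∑ φ ∈ Finset.univ.image l ∪ Finset.univ.image r, c φ • b φ := by
      ext e
      simp [hc, b, Finset.sum_apply, mul_add, Finset.sum_add_distrib]
    rw [this]
    exact Submodule.sum_mem _ fun φ _ => Submodule.smul_mem _ _ (Submodule.subset_span ⟨φ, rfl⟩)
  obtain ⟨s, hs, hsspan, hsind⟩ := exists_linearIndependent (ZMod 2) (Set.range b)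
  let J : Finset (ι → ZMod 2) := s.toFinset
  have hmem : ∀ y, y ∈ J ↔ y ∈ s := fun y => Set.mem_toFinset
  have hcard : J.card = Module.finrank (ZMod 2) Z := by
    rw [← hspan, ← hsspan, finrank_span_set_eq_card hsind]
  have hcover : ∀ e, (J.filter fun y => y e ≠ 0).card ≤ 2 := fun e => by
    refine (Finset.card_le_card (t := {b (l e), b (r e)}) fun y hy => ?_).trans
      Finset.card_le_two
    obtain ⟨hyJ, hye⟩ := Finset.mem_filter.mp hy
    obtain ⟨φ, rfl⟩ := hs ((hmem y).mp hyJ)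
    have : l e = φ ∨ r e = φ := by
      by_contra! h
      exact hye (by simp [b, h.1, h.2])
    rcases this with rfl | rfl <;> simp
  have hind : ∀ t ⊆ J, ∑ y ∈ t, y = 0 → t = ∅ := by
    intro t ht h
    have hl := linearIndepOn_finset_iff.mp
      (LinearIndepOn.mono (t := (t : Set (ι → ZMod 2))) (s := s) (v := id) hsind
        fun y hy => (hmem y).mp (ht hy)) (fun _ => 1) (by simpa using h)
    exact Finset.eq_empty_of_forall_notMem fun y hy => one_ne_zero (hl y hy)
  have hsum : ∑ y ∈ J, y ∉ J := by
    intro h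
    have h1 := Finset.sum_erase_add J id h
    simp only [id, add_eq_right] at h1
    have h2 := hind _ (Finset.erase_subset _ _) h1
    have h3 := Finset.card_erase_of_mem h
    rw [h2, Finset.card_empty] at h3
    omega
  refine ⟨insert (∑ y ∈ J, y) J, ?_, ?_, fun e => ?_⟩
  · rw [Finset.card_insert_of_notMem hsum, hcard]
  · have hJZ : ∀ y ∈ J, y ∈ Z := fun y hy =>
      hspan ▸ Submodule.subset_span (hs ((hmem y).mp hy))
    intro y hy
    rcases Finset.mem_insert.mp hy with rfl | hy
    · refine ⟨Submodule.sum_mem _ hJZ, fun h => ?_⟩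
      have := hind J subset_rfl h
      rw [this, Finset.card_empty] at hcard
      omega
    · refine ⟨hJZ y hy, fun h => ?_⟩
      have := hind {y} (by simpa using hy) (by simpa using h)
      simp at this
  · rw [Finset.filter_insert]
    split_ifs with h
    · have hval : (∑ y ∈ J, y) e = ((J.filter fun y => y e ≠ 0).card : ZMod 2) := by
        have hone : ∀ a : ZMod 2, a = ((if a ≠ 0 then 1 else 0 : ℕ) : ZMod 2) := by decide
        rw [Finset.sum_apply, Finset.card_filter, Nat.cast_sum]
        exact Finset.sum_congr rfl fun y _ => hone (y e)
      have : (J.filter fun y => y e ≠ 0).card ≠ 2 := fun h2 => by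
        rw [hval, h2] at h
        exact h rfl
      have := hcover e
      have := Finset.card_insert_le (∑ y ∈ J, y) (J.filter fun y => y e ≠ 0)
      omega
    · exact hcover e

end Counting

section CycleSpace

variable {ι V : Type*} [Fintype ι] {u w : ι → V}

lemma card_le_finrank_cycleSpace [Fintype V] [Nonempty V] (u w : ι → V) :
    Fintype.card ι + 1 ≤ Module.finrank (ZMod 2) (cycleSpace u w) + Fintype.card V := by
  classical
  let A : (ι → ZMod 2) →ₗ[ZMod 2] (V → ZMod 2) := LinearMap.pi fun v =>
    ∑ e, ((if u e = v then 1 else 0) + (if w e = v then 1 else 0) : ZMod 2) • LinearMap.proj e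
  have hker : LinearMap.ker A = cycleSpace u w := by
    ext y
    simp [A, cycleSpace, funext_iff, LinearMap.sum_apply, mul_comm]
  let S : (V → ZMod 2) →ₗ[ZMod 2] ZMod 2 := ∑ v, LinearMap.proj v
  have hS : Function.Surjective S := fun a =>
    ⟨Pi.single (Classical.arbitrary V) a, by simp [S, LinearMap.sum_apply]⟩
  have hrange : LinearMap.range A ≤ LinearMap.ker S := by
    rintro _ ⟨y, rfl⟩
    simp only [A, S, LinearMap.mem_ker, LinearMap.sum_apply, LinearMap.proj_apply,
      LinearMap.pi_apply, LinearMap.smul_apply, smul_eq_mul]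
    rw [Finset.sum_comm]
    refine Finset.sum_eq_zero fun e _ => ?_
    rw [← Finset.sum_mul, Finset.sum_add_distrib]
    simp [CharTwo.add_self_eq_zero]
  have h1 := LinearMap.finrank_range_add_finrank_ker A
  have h2 := LinearMap.finrank_range_add_finrank_ker S
  rw [LinearMap.range_eq_top.mpr hS, finrank_top, Module.finrank_self,
    Module.finrank_fintype_fun_eq_card] at h2
  rw [hker, Module.finrank_fintype_fun_eq_card] at h1
  have h3 := Submodule.finrank_mono hrange
  omega

/-- An edge of a cycle is followed by another edge at either of its ends. -/
lemma exists_next_edge {y : ι → ZMod 2} (hy : y ∈ cycleSpace u w) (hne : ∀ e, u e ≠ w e)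
    {e : ι} (he : y e ≠ 0) {v : V} (hv : v ∈ s(u e, w e)) :
    ∃ f, f ≠ e ∧ y f ≠ 0 ∧ v ∈ s(u f, w f) := by
  classical
  by_contra! h
  have h0 := hy v
  rw [Finset.sum_eq_single e] at h0
  · have h1 : (if u e = v then (1 : ZMod 2) else 0) + (if w e = v then 1 else 0) = 1 := by
      rcases Sym2.mem_iff.mp hv with rfl | rfl
      · simp [(hne e).symm]
      · simp [hne e]
    rw [h1, mul_one] at h0
    exact he h0
  · intro f _ hf
    by_cases hyf : y f = 0
    · rw [hyf, zero_mul]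
    · have := h f hf hyf
      simp only [Sym2.mem_iff, not_or] at this
      simp [Ne.symm this.1, Ne.symm this.2]
  · simp

/-- Starting from an edge `ab` of a cycle one finds two further edges `ax` and `bx'`. -/
lemma exists_path_in_cycle {y : ι → ZMod 2} (hy : y ∈ cycleSpace u w) (hne : ∀ e, u e ≠ w e)
    (huw : Function.Injective fun e => s(u e, w e)) {e : ι} (he : y e ≠ 0) :
    ∃ f g x x', e ≠ f ∧ e ≠ g ∧ f ≠ g ∧ y f ≠ 0 ∧ y g ≠ 0 ∧
      s(u f, w f) = s(u e, x) ∧ s(u g, w g) = s(w e, x') ∧ x ≠ w e ∧ x' ≠ u e := by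
  obtain ⟨f, hfe, hf, hfu⟩ := exists_next_edge hy hne he (Sym2.mem_mk_left _ _)
  obtain ⟨g, hge, hg, hgw⟩ := exists_next_edge hy hne he (Sym2.mem_mk_right _ _)
  obtain ⟨x, hx⟩ := Sym2.mem_iff_exists.mp hfu
  obtain ⟨x', hx'⟩ := Sym2.mem_iff_exists.mp hgw
  have hx1 : x ≠ w e := by
    rintro rfl
    exact hfe (huw hx)
  have hx2 : x' ≠ u e := by
    rintro rfl
    exact hge (huw (hx'.trans Sym2.eq_swap))
  refine ⟨f, g, x, x', hfe.symm, hge.symm, ?_, hf, hg, hx, hx', hx1, hx2⟩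
  rintro rfl
  rw [hx, Sym2.eq_iff] at hx'
  rcases hx' with h | h
  exacts [hne e h.1, hx2 h.1.symm]

lemma three_le_card_supp {y : ι → ZMod 2} (hy : y ∈ cycleSpace u w) (hne : ∀ e, u e ≠ w e)
    (huw : Function.Injective fun e => s(u e, w e)) (hy0 : y ≠ 0) : 3 ≤ (supp y).card := by
  classical
  obtain ⟨e, he⟩ := supp_nonempty hy0
  rw [mem_supp] at he
  obtain ⟨f, g, -, -, h1, h2, h3, hf, hg, -⟩ := exists_path_in_cycle hy hne huw he
  rw [← Finset.card_eq_three.mpr ⟨e, f, g, h1, h2, h3, rfl⟩]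
  refine Finset.card_le_card ?_
  simp [Finset.insert_subset_iff, he, hf, hg]

/-- A cycle with three edges is a triangle. -/
lemma exists_triangle [DecidableEq ι] {y : ι → ZMod 2} (hy : y ∈ cycleSpace u w)
    (hne : ∀ e, u e ≠ w e) (huw : Function.Injective fun e => s(u e, w e))
    (hcard : (supp y).card = 3) {e : ι} (he : y e ≠ 0) :
    ∃ f g x, supp y = {e, f, g} ∧ s(u f, w f) = s(u e, x) ∧ s(u g, w g) = s(w e, x) := by
  obtain ⟨f, g, x, x', h1, h2, h3, hf, hg, hfx, hgx, hx, hx'⟩ :=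
    exists_path_in_cycle hy hne huw he
  have hsupp : supp y = {e, f, g} := by
    refine (Finset.eq_of_subset_of_card_le ?_ ?_).symm
    · simp [Finset.insert_subset_iff, he, hf, hg]
    · rw [hcard, Finset.card_eq_three.mpr ⟨e, f, g, h1, h2, h3, rfl⟩]
  have hxu : x ≠ u e := by
    rintro rfl
    have hd : (s(u f, w f)).IsDiag ↔ u f = w f := Sym2.mk_isDiag_iff
    exact hne f (hd.mp (hfx ▸ Sym2.mk_isDiag_iff.mpr rfl))
  obtain ⟨k, hk, hyk, hxk⟩ := exists_next_edge (v := x) hy hne hf (by simp [hfx])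
  have hk' : k ∈ supp y := mem_supp.mpr hyk
  simp only [hsupp, Finset.mem_insert, Finset.mem_singleton] at hk'
  rcases hk' with rfl | rfl | rfl
  · rcases Sym2.mem_iff.mp hxk with h | h
    exacts [absurd h hxu, absurd h hx]
  · exact absurd rfl hk
  · rw [hgx] at hxk
    rcases Sym2.mem_iff.mp hxk with h | h
    · exact absurd h hx
    · exact ⟨f, k, x, hsupp, hfx, h ▸ hgx⟩

end CycleSpace

/-! ### Discretization of compact connected sets -/

/-- The point of the grid of mesh `δ` with the given integer coordinates. -/
def gridPoint (δ : ℝ) (c : ℤ × ℤ) : ℝ × ℝ := (δ * c.1, δ * c.2)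

/-- The grid points at distance less than `δ` from `K`. -/
def fat (δ : ℝ) (K : Set (ℝ × ℝ)) : Set (ℤ × ℤ) := {c | ∃ p ∈ K, dist p (gridPoint δ c) < δ}

lemma exists_dist_gridPoint_le {δ : ℝ} (hδ : 0 < δ) (p : ℝ × ℝ) :
    ∃ c, dist p (gridPoint δ c) ≤ δ / 2 := by
  have key : ∀ x : ℝ, dist x (δ * (round (x / δ) : ℤ)) ≤ δ / 2 := fun x => by
    have h := abs_sub_round (x / δ)
    have hx : x - δ * (round (x / δ) : ℤ) = δ * (x / δ - (round (x / δ) : ℤ)) := by field_simp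
    rw [Real.dist_eq, hx, abs_mul, abs_of_pos hδ]
    nlinarith
  exact ⟨(round (p.1 / δ), round (p.2 / δ)), max_le (key p.1) (key p.2)⟩

lemma linked_fat_of_near {δ : ℝ} (hδ : 0 < δ) {K : Set (ℝ × ℝ)} {p : ℝ × ℝ} (hp : p ∈ K)
    {a b : ℤ × ℤ} (ha : dist p (gridPoint δ a) < δ) (hb : dist p (gridPoint δ b) < δ) :
    Linked (fat δ K) a b := by
  have step : ∀ (x : ℝ) (i j : ℤ), dist x (δ * i) < δ → dist x (δ * j) < δ →
      i = j ∨ i + 1 = j ∨ j + 1 = i := by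
    intro x i j hi hj
    have h : dist (δ * (i : ℝ)) (δ * j) < δ * 2 := by
      have := dist_triangle_left (δ * (i : ℝ)) (δ * j) x
      linarith
    rw [Real.dist_eq, ← mul_sub, abs_mul, abs_of_pos hδ, mul_lt_mul_iff_right₀ hδ] at h
    have h' : |i - j| < 2 := by exact_mod_cast h
    rw [abs_lt] at h'
    omega
  obtain ⟨i, j⟩ := a
  obtain ⟨i', j'⟩ := b
  obtain ⟨ha1, ha2⟩ := max_lt_iff.mp ha
  obtain ⟨hb1, hb2⟩ := max_lt_iff.mp hb
  have hmem : (i, j) ∈ fat δ K := ⟨p, hp, ha⟩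
  have hmem' : (i', j) ∈ fat δ K := ⟨p, hp, max_lt hb1 ha2⟩
  have hmem'' : (i', j') ∈ fat δ K := ⟨p, hp, hb⟩
  have h1 : Linked (fat δ K) (i, j) (i', j) := by
    rcases step _ _ _ ha1 hb1 with rfl | rfl | rfl
    · exact .refl
    · exact .single ⟨⟨(false, i, j), Or.inl ⟨rfl, rfl⟩⟩, hmem, hmem'⟩
    · exact .single ⟨⟨(false, i', j), Or.inr ⟨rfl, rfl⟩⟩, hmem, hmem'⟩
  have h2 : Linked (fat δ K) (i', j) (i', j') := by
    rcases step _ _ _ ha2 hb2 with rfl | rfl | rfl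
    · exact .refl
    · exact .single ⟨⟨(true, i', j), Or.inl ⟨rfl, rfl⟩⟩, hmem', hmem''⟩
    · exact .single ⟨⟨(true, i', j'), Or.inr ⟨rfl, rfl⟩⟩, hmem', hmem''⟩
  exact h1.trans h2

lemma linked_fat {δ : ℝ} (hδ : 0 < δ) {K : Set (ℝ × ℝ)} (hK : IsPreconnected K)
    {a b : ℤ × ℤ} (ha : a ∈ fat δ K) (hb : b ∈ fat δ K) : Linked (fat δ K) a b := by
  obtain ⟨p, hp, hpa⟩ := ha
  obtain ⟨q, hq, hqb⟩ := hb
  let P : ℝ × ℝ → ℝ × ℝ → Prop := fun x y => ∀ a b, dist x (gridPoint δ a) < δ →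
    dist y (gridPoint δ b) < δ → Linked (fat δ K) a b
  refine hK.induction₂ P ?_ ?_ ?_ hp hq a b hpa hqb
  · intro x hx
    obtain ⟨c, hc⟩ := exists_dist_gridPoint_le hδ x
    filter_upwards [self_mem_nhdsWithin,
      mem_nhdsWithin_of_mem_nhds (Metric.ball_mem_nhds x (half_pos hδ))] with y hy hyx
    intro a b ha hb
    refine (linked_fat_of_near (b := c) hδ hx ha (by linarith)).trans
      (linked_fat_of_near hδ hy ?_ hb)
    have := dist_triangle y x (gridPoint δ c)
    rw [Metric.mem_ball] at hyx
    linarith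
  · intro x y z _ hy _ hxy hyz a b ha hb
    obtain ⟨c, hc⟩ := exists_dist_gridPoint_le hδ y
    exact (hxy a c ha (by linarith)).trans (hyz c b (by linarith) hb)
  · intro x y _ _ hxy a b ha hb
    exact (hxy b a hb ha).symm

lemma fat_finite {δ : ℝ} (hδ : 0 < δ) {K : Set (ℝ × ℝ)} (hK : Bornology.IsBounded K) :
    (fat δ K).Finite := by
  obtain ⟨R, hR⟩ := hK.subset_closedBall 0
  let N := ⌈(R + δ) / δ⌉
  have key : ∀ (x : ℝ) (i : ℤ), dist x 0 ≤ R → dist x (δ * i) < δ → i ∈ Set.Icc (-N) N := by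
    intro x i hx hi
    have h : dist 0 (δ * (i : ℝ)) < R + δ := by
      have := dist_triangle_left 0 (δ * (i : ℝ)) x
      linarith
    rw [Real.dist_eq, zero_sub, abs_neg, abs_mul, abs_of_pos hδ] at h
    have h' : |(i : ℝ)| ≤ N := ((lt_div_iff₀' hδ).mpr h).le.trans (Int.le_ceil _)
    exact abs_le.mp (by exact_mod_cast h')
  refine ((Set.finite_Icc (-N) N).prod (Set.finite_Icc (-N) N)).subset ?_
  rintro ⟨i, j⟩ ⟨p, hp, hd⟩
  obtain ⟨hd1, hd2⟩ := max_lt_iff.mp hd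
  obtain ⟨hR1, hR2⟩ := max_le_iff.mp (Metric.mem_closedBall.mp (hR hp))
  exact ⟨key _ _ hR1 hd1, key _ _ hR2 hd2⟩

lemma eventually_disjoint_fat {K L : Set (ℝ × ℝ)} (hK : IsCompact K) (hL : IsCompact L)
    (h : Disjoint K L) : ∀ᶠ δ in 𝓝[>] (0 : ℝ), Disjoint (fat δ K) (fat δ L) := by
  obtain ⟨r, hr, hd⟩ := h.exists_thickenings hK hL.isClosed
  filter_upwards [Ioo_mem_nhdsGT hr] with δ hδ
  have hmem : ∀ {A : Set (ℝ × ℝ)} {c}, c ∈ fat δ A → gridPoint δ c ∈ Metric.thickening r A :=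
    fun ⟨p, hp, hpc⟩ =>
      Metric.mem_thickening_iff.mpr ⟨p, hp, (_root_.dist_comm _ _).trans_lt (hpc.trans hδ.2)⟩
  exact Set.disjoint_left.mpr fun c hcK hcL => Set.disjoint_left.mp hd (hmem hcK) (hmem hcL)

/-! ### Grid models of plane graphs -/

/-- Disjoint plane continua `K v`, one for each vertex, together with disjoint continua `M e`
joining them along the edges, give a grid model. -/
theorem nonempty_gridModel {ι V : Type*} [Finite ι] [Finite V] {u w : ι → V}
    (hne : ∀ e, u e ≠ w e) (K : V → Set (ℝ × ℝ)) (M : ι → Set (ℝ × ℝ))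
    (hKc : ∀ v, IsCompact (K v)) (hKconn : ∀ v, IsConnected (K v))
    (hMc : ∀ e, IsCompact (M e)) (hMconn : ∀ e, IsPreconnected (M e))
    (hKK : ∀ v v', v ≠ v' → Disjoint (K v) (K v'))
    (hMM : ∀ e f, e ≠ f → Disjoint (M e) (M f))
    (hMK : ∀ e v, v ≠ u e → v ≠ w e → Disjoint (M e) (K v))
    (hMu : ∀ e, (M e ∩ K (u e)).Nonempty) (hMw : ∀ e, (M e ∩ K (w e)).Nonempty) :
    Nonempty (GridModel u w) := by
  have hev : ∀ᶠ δ in 𝓝[>] (0 : ℝ), 0 < δ ∧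
      (∀ v v', v ≠ v' → Disjoint (fat δ (K v)) (fat δ (K v'))) ∧
      (∀ e f, e ≠ f → Disjoint (fat δ (M e)) (fat δ (M f))) ∧
      (∀ e v, v ≠ u e → v ≠ w e → Disjoint (fat δ (M e)) (fat δ (K v))) := by
    refine (eventually_mem_nhdsWithin (s := Set.Ioi (0 : ℝ))).and
      (Filter.Eventually.and ?_ (Filter.Eventually.and ?_ ?_))
    · simp only [Filter.eventually_all]
      exact fun v v' h => eventually_disjoint_fat (hKc v) (hKc v') (hKK v v' h)
    · simp only [Filter.eventually_all]
      exact fun e f h => eventually_disjoint_fat (hMc e) (hMc f) (hMM e f h)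
    · simp only [Filter.eventually_all]
      exact fun e v h h' => eventually_disjoint_fat (hMc e) (hKc v) (hMK e v h h')
  obtain ⟨δ, hδ, hKK', hMM', hMK'⟩ := hev.exists
  have hfat : ∀ {A B : Set (ℝ × ℝ)}, (A ∩ B).Nonempty → ∃ c, c ∈ fat δ A ∧ c ∈ fat δ B := by
    rintro A B ⟨p, hpA, hpB⟩
    obtain ⟨c, hc⟩ := exists_dist_gridPoint_le hδ p
    exact ⟨c, ⟨p, hpA, by linarith⟩, ⟨p, hpB, by linarith⟩⟩
  choose a haM haK using fun e => hfat (hMu e)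
  choose b hbM hbK using fun e => hfat (hMw e)
  choose root hroot _ using fun v => hfat (A := K v) (B := K v) (by simpa using (hKconn v).1)
  have hentry : ∀ e, ∃ x y, Linked (fat δ (M e) \ fat δ (K (w e))) (a e) x ∧
      x ∉ fat δ (K (w e)) ∧ y ∈ fat δ (K (w e)) ∧ GridAdj x y := fun e =>
    (linked_fat hδ (hMconn e) (haM e) (hbM e)).exists_entry
      (Set.disjoint_left.mp (hKK' _ _ (hne e)) (haK e)) (hbK e)
  choose x y hax _ hy hxy using hentry
  choose link hlink using hxy
  let Q : ι → Set (ℤ × ℤ) := fun e =>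
    {c | c ∈ fat δ (M e) \ fat δ (K (w e)) ∧ Linked (fat δ (M e) \ fat δ (K (w e))) (a e) c}
  have haQ : ∀ e, a e ∈ Q e := fun e =>
    ⟨⟨haM e, Set.disjoint_left.mp (hKK' _ _ (hne e)) (haK e)⟩, .refl⟩
  have hQlinked : ∀ e, ∀ c ∈ Q e, Linked (Q e) (a e) c := by
    rintro e c ⟨-, hc⟩
    induction hc with
    | refl => exact .refl
    | tail hp hpq ih => exact ih.tail ⟨hpq.1, ⟨hpq.2.1, hp⟩, ⟨hpq.2.2, hp.tail hpq⟩⟩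
  have hxQ : ∀ e, x e ∈ Q e := fun e => by
    refine ⟨?_, hax e⟩
    rcases Relation.ReflTransGen.cases_tail (hax e) with h | ⟨_, _, h⟩
    · exact h ▸ (haQ e).1
    · exact h.2.2
  have hQK : ∀ e v, v ≠ u e → ∀ c ∈ Q e, c ∉ fat δ (K v) := by
    intro e v hv c hc hcv
    by_cases hw : v = w e
    · exact hc.1.2 (hw ▸ hcv)
    · exact Set.disjoint_left.mp (hMK' e v hv hw) hc.1.1 hcv
  let B : V → Set (ℤ × ℤ) := fun v => fat δ (K v) ∪ ⋃ e ∈ {e | u e = v}, Q e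
  have hBmem : ∀ v c, c ∈ B v ↔ c ∈ fat δ (K v) ∨ ∃ e, u e = v ∧ c ∈ Q e := by
    simp [B]
  have hBfin : ∀ v, (B v).Finite := fun v =>
    (fat_finite hδ (hKc v).isBounded).union <| (Set.toFinite _).biUnion fun e _ =>
      (fat_finite hδ (hMc e).isBounded).subset fun c hc => hc.1.1
  have hBroot : ∀ v, ∀ c ∈ B v, Linked (B v) (root v) c := by
    intro v c hc
    have h0 : ∀ d ∈ fat δ (K v), Linked (B v) (root v) d := fun d hd =>
      (linked_fat hδ (hKconn v).isPreconnected (hroot v) hd).mono Set.subset_union_left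
    rcases (hBmem v c).mp hc with h | ⟨e, rfl, h⟩
    · exact h0 c h
    · exact (h0 _ (haK e)).trans
        ((hQlinked e c h).mono fun d hd => (hBmem _ d).mpr (Or.inr ⟨e, rfl, hd⟩))
  refine ⟨⟨fun v => (hBfin v).toFinset, link, root, fun v => ?_, fun v v' c hc hc' => ?_,
    fun v p hp q hq => ?_, fun e => ?_⟩⟩
  · simpa using (hBmem v _).mpr (Or.inl (hroot v))
  · rw [Set.Finite.mem_toFinset, hBmem] at hc hc'
    by_contra hvv
    rcases hc with hc | ⟨e, rfl, hc⟩ <;> rcases hc' with hc' | ⟨f, rfl, hc'⟩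
    · exact Set.disjoint_left.mp (hKK' _ _ hvv) hc hc'
    · exact hQK f v hvv c hc' hc
    · exact hQK e v' (Ne.symm hvv) c hc hc'
    · exact Set.disjoint_left.mp (hMM' e f fun h => hvv (h ▸ rfl)) hc.1.1 hc'.1.1
  · rw [Set.Finite.mem_toFinset] at hp hq
    rw [Set.Finite.coe_toFinset]
    exact (hBroot v p hp).symm.trans (hBroot v q hq)
  · have h1 : x e ∈ B (u e) := (hBmem _ _).mpr (Or.inr ⟨e, rfl, hxQ e⟩)
    have h2 : y e ∈ B (w e) := (hBmem _ _).mpr (Or.inl (hy e))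
    simp only [Set.Finite.mem_toFinset]
    rcases hlink e with ⟨h, h'⟩ | ⟨h, h'⟩
    · exact Or.inl ⟨h ▸ h1, h' ▸ h2⟩
    · exact Or.inr ⟨h ▸ h2, h' ▸ h1⟩

section PlaneGraph

variable {V : Type*} {G : SimpleGraph V}

/-- A planar graph with chosen edge orientations has a grid model. -/
theorem nonempty_gridModel_of_hasPlanarEmbedding [Finite V] (hG : G.HasPlanarEmbedding)
    {u w : G.edgeSet → V} (huw : ∀ e, s(u e, w e) = e.1) : Nonempty (GridModel u w) := by
  obtain ⟨pos, arc, hpos, harc, hdisj⟩ := hG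
  have hadj : ∀ e, G.Adj (u e) (w e) := fun e => by
    rw [← SimpleGraph.mem_edgeSet, huw]
    exact e.2
  have meet : ∀ {a b c d s t}, G.Adj a b → G.Adj c d → s ∈ Set.Ioo (0 : ℝ) 1 →
      t ∈ Set.Ioo (0 : ℝ) 1 → arc a b s = arc c d t →
      (a = c ∧ b = d) ∨ (a = d ∧ b = c ∧ s = 1 - t) := by
    intro a b c d s t hab hcd hs ht h
    have hs' : s(a, b) = s(c, d) := by
      by_contra hne
      exact hdisj a b c d hab hcd hne s hs t ht h
    rcases Sym2.eq_iff.mp hs' with h' | ⟨rfl, rfl⟩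
    · exact Or.inl h'
    · refine Or.inr ⟨rfl, rfl, ?_⟩
      obtain ⟨-, hinj, -, -, hrev, -⟩ := harc _ _ hab
      have hrev' := (harc _ _ hcd).2.2.2.2.1 t
      exact hinj (Set.Ioo_subset_Icc_self hs)
        ⟨by linarith [ht.2], by linarith [ht.1]⟩ (h.trans hrev')
  let K : V → Set (ℝ × ℝ) := fun v =>
    {pos v} ∪ ⋃ x ∈ {x | G.Adj v x}, arc v x '' Set.Icc 0 (1 / 3)
  let M : G.edgeSet → Set (ℝ × ℝ) := fun e => arc (u e) (w e) '' Set.Icc (1 / 3) (2 / 3)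
  have hcont : ∀ {v x}, G.Adj v x → ∀ {a b : ℝ}, 0 ≤ a → b ≤ 1 →
      ContinuousOn (arc v x) (Set.Icc a b) := fun h _ _ ha hb =>
    (harc _ _ h).1.mono (Set.Icc_subset_Icc ha hb)
  have hK : ∀ {v p}, p ∈ K v → p = pos v ∨
      ∃ x t, G.Adj v x ∧ t ∈ Set.Ioc (0 : ℝ) (1 / 3) ∧ arc v x t = p := by
    intro v p hp
    simp only [K, Set.mem_union, Set.mem_singleton_iff, Set.mem_iUnion, Set.mem_image] at hp
    rcases hp with hp | ⟨x, hx, t, ht, rfl⟩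
    · exact Or.inl hp
    · rcases ht.1.eq_or_lt with rfl | h0
      · exact Or.inl (harc v x hx).2.2.1
      · exact Or.inr ⟨x, t, hx, ⟨h0, ht.2⟩, rfl⟩
  have hKarc : ∀ {v x t}, G.Adj v x → t ∈ Set.Icc (0 : ℝ) (1 / 3) → arc v x t ∈ K v :=
    fun {v x t} hx ht => Or.inr (Set.mem_biUnion (show x ∈ {x | G.Adj v x} from hx) ⟨t, ht, rfl⟩)
  have havoid : ∀ {a b t}, G.Adj a b → t ∈ Set.Ioo (0 : ℝ) 1 → ∀ v, arc a b t ≠ pos v :=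
    fun h ht v => (harc _ _ h).2.2.2.2.2 v _ ht
  have hthird : ∀ {t : ℝ}, t ∈ Set.Ioc (0 : ℝ) (1 / 3) → t ∈ Set.Ioo (0 : ℝ) 1 :=
    fun ht => ⟨ht.1, by linarith [ht.2]⟩
  have hmid : ∀ {t : ℝ}, t ∈ Set.Icc (1 / 3 : ℝ) (2 / 3) → t ∈ Set.Ioo (0 : ℝ) 1 :=
    fun ht => ⟨by linarith [ht.1], by linarith [ht.2]⟩
  refine nonempty_gridModel (fun e => (hadj e).ne) K M (fun v => ?_) (fun v => ?_)
    (fun e => ?_) (fun e => ?_) (fun v v' hv => ?_) (fun e f hef => ?_)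
    (fun e v hvu hvw => ?_) (fun e => ?_) (fun e => ?_)
  · exact isCompact_singleton.union <| (Set.toFinite _).isCompact_biUnion fun x hx =>
      isCompact_Icc.image_of_continuousOn (hcont hx le_rfl (by norm_num))
  · refine ⟨⟨pos v, Or.inl rfl⟩, isPreconnected_of_forall (pos v) fun p hp => ?_⟩
    rcases hK hp with rfl | ⟨x, t, hx, ht, rfl⟩
    · exact ⟨{pos v}, Set.subset_union_left, rfl, rfl, isPreconnected_singleton⟩
    · refine ⟨arc v x '' Set.Icc 0 (1 / 3), ?_, ⟨0, by norm_num, (harc v x hx).2.2.1⟩,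
        ⟨t, ⟨ht.1.le, ht.2⟩, rfl⟩,
        isPreconnected_Icc.image _ (hcont hx le_rfl (by norm_num))⟩
      rintro _ ⟨t, ht, rfl⟩
      exact hKarc hx ht
  · exact isCompact_Icc.image_of_continuousOn (hcont (hadj e) (by norm_num) (by norm_num))
  · exact isPreconnected_Icc.image _ (hcont (hadj e) (by norm_num) (by norm_num))
  · refine Set.disjoint_left.mpr fun p hp hp' => ?_
    rcases hK hp with rfl | ⟨x, s, hx, hs, rfl⟩ <;> rcases hK hp' with h | ⟨y, t, hy, ht, h⟩
    · exact hv (hpos h)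
    · exact havoid hy (hthird ht) _ h
    · exact havoid hx (hthird hs) _ h
    · rcases meet hx hy (hthird hs) (hthird ht) h.symm with h' | h'
      · exact hv h'.1
      · linarith [h'.2.2, hs.2, ht.2]
  · refine Set.disjoint_left.mpr ?_
    rintro _ ⟨s, hs, rfl⟩ ⟨t, ht, h⟩
    have heq : s(u e, w e) = s(u f, w f) := by
      rw [Sym2.eq_iff]
      exact (meet (hadj e) (hadj f) (hmid hs) (hmid ht) h.symm).imp_right
        fun h' => ⟨h'.1, h'.2.1⟩
    exact hef (Subtype.ext (by rw [← huw, ← huw, heq]))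
  · refine Set.disjoint_left.mpr ?_
    rintro _ ⟨s, hs, rfl⟩ hp
    rcases hK hp with h | ⟨x, t, hx, ht, h⟩
    · exact havoid (hadj e) (hmid hs) _ h
    · rcases meet hx (hadj e) (hthird ht) (hmid hs) h with h' | h'
      exacts [hvu h'.1, hvw h'.1]
  · exact ⟨_, ⟨1 / 3, by norm_num, rfl⟩, hKarc (hadj e) (by norm_num)⟩
  · refine ⟨_, ⟨2 / 3, by norm_num, rfl⟩, ?_⟩
    rw [(harc _ _ (hadj e)).2.2.2.2.1]
    exact hKarc (hadj e).symm (by norm_num)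

/-- Two triangles on a common edge form a copy of `theta4`. -/
lemma containsCopy_theta4 {a b x y : V} (hab : G.Adj a b) (hax : G.Adj a x) (hbx : G.Adj b x)
    (hay : G.Adj a y) (hby : G.Adj b y) (hxy : x ≠ y) : ContainsCopy theta4 G := by
  refine ⟨⟨![a, x, b, y], fun {i j} h => ?_⟩, fun i j h => ?_⟩
  · fin_cases i <;> fin_cases j <;> simp [theta4, hab, hab.symm, hax, hax.symm, hbx,
      hbx.symm, hay, hay.symm, hby, hby.symm] at h ⊢
  · have := hab.ne
    have := hax.ne
    have := hbx.ne
    have := hay.ne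
    have := hby.ne
    fin_cases i <;> fin_cases j <;> simp_all

/-- In a graph without `theta4`, distinct triangles of the cycle space share no edge. -/
lemma triangle_unique [Fintype G.edgeSet] (hfree : ¬ ContainsCopy theta4 G)
    {u w : G.edgeSet → V} (huw : ∀ e, s(u e, w e) = e.1) (hne : ∀ e, u e ≠ w e)
    {y z : G.edgeSet → ZMod 2} (hy : y ∈ cycleSpace u w) (hz : z ∈ cycleSpace u w)
    (hy3 : (supp y).card = 3) (hz3 : (supp z).card = 3) {e : G.edgeSet} (hye : y e ≠ 0)
    (hze : z e ≠ 0) : y = z := by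
  classical
  have hinj : Function.Injective fun e => s(u e, w e) := fun e f h =>
    Subtype.ext (by rw [← huw, ← huw]; exact h)
  obtain ⟨f, g, a, hs, hf, hg⟩ := exists_triangle hy hne hinj hy3 hye
  obtain ⟨f', g', a', hs', hf', hg'⟩ := exists_triangle hz hne hinj hz3 hze
  have hadj : ∀ {e p q}, s(u e, w e) = s(p, q) → G.Adj p q := fun {e p q} h => by
    rw [← SimpleGraph.mem_edgeSet, ← h, huw]
    exact e.2
  have haa : a = a' := by
    by_contra h
    exact hfree (containsCopy_theta4 (hadj (e := e) rfl) (hadj hf) (hadj hg) (hadj hf')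
      (hadj hg') h)
  subst haa
  rw [hinj (hf.trans hf'.symm), hinj (hg.trans hg'.symm), ← hs'] at hs
  exact supp_injective hs

end PlaneGraph

end PlanarTuran

open PlanarTuran

/-- For every `n ≥ 4`, every planar simple graph on `n` vertices containing no member of
`Θ₄` (i.e. no copy of `K₄` minus an edge) as a subgraph has at most `12(n-2)/5` edges. -/
theorem planar_turan_theta4 (n : ℕ) (hn : 4 ≤ n)
    (V : Type*) [Fintype V] (G : SimpleGraph V) (hcard : Fintype.card V = n)
    (hplanar : G.HasPlanarEmbedding) (hfree : ¬ ContainsCopy theta4 G) :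
    (G.edgeSet.ncard : ℝ) ≤ 12 * ((n : ℝ) - 2) / 5 := by
  classical
  obtain ⟨u, w, huw⟩ : ∃ u w : G.edgeSet → V, ∀ e, s(u e, w e) = e.1 :=
    ⟨fun e => e.1.out.1, fun e => e.1.out.2, fun e => Quot.out_eq e.1⟩
  have hne : ∀ e, u e ≠ w e := fun e => by
    have h : G.Adj (u e) (w e) := by
      rw [← SimpleGraph.mem_edgeSet, huw]
      exact e.2
    exact h.ne
  have hinj : Function.Injective fun e => s(u e, w e) := fun e f h =>
    Subtype.ext (by rw [← huw, ← huw]; exact h)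
  have : Nonempty V := Fintype.card_pos_iff.mp (by omega)
  have hdim := card_le_finrank_cycleSpace u w
  have hm : G.edgeSet.ncard = Fintype.card G.edgeSet := by
    rw [← Nat.card_coe_set_eq, Nat.card_eq_fintype_card]
  have main : 5 * Fintype.card G.edgeSet + 24 ≤ 12 * n := by
    by_cases h2 : 2 ≤ Module.finrank (ZMod 2) (cycleSpace u w)
    · obtain ⟨M⟩ := nonempty_gridModel_of_hasPlanarEmbedding hplanar huw
      obtain ⟨Φ, l, r, hdual⟩ := M.exists_dual hne hinj
      obtain ⟨J, hJ, hJZ, hJ2⟩ := exists_double_cover _ l r hdual h2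
      have := card_le_of_double_cover J
        (fun y hy => three_le_card_supp (hJZ y hy).1 hne hinj (hJZ y hy).2) hJ2
        fun y hy z hz hy3 hz3 e hye hze =>
          triangle_unique hfree huw hne (hJZ y hy).1 (hJZ z hz).1 hy3 hz3 hye hze
      omega
    · omega
  rw [hm, le_div_iff₀ (by norm_num)]
  have : (5 * Fintype.card G.edgeSet + 24 : ℝ) ≤ 12 * n := by exact_mod_cast main
  linarith
end

section
/- For every integer k ≥ 0, setting n = 20k + 12, there exists a planar simple graph on n vertices that contains no subgraph isomorphic to K₄ minus an edge and has exactly 12(n−2)/5 edges. Consequently ex_P(n, Θ₄) = 12(n−2)/5 whenever n ≡ 12 (mod 20). -/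
open SimpleGraph

section AbstractDual

variable {V : Type*} [Fintype V] [DecidableEq V] {G : SimpleGraph V} [Fintype G.edgeSet]

/-- The maps `l` and `r`, giving the two faces at each edge, make `Q` the vertex set of an abstract
dual of `G`: the even edge sets of `G` are exactly the cuts of the dual. -/
def IsAbstractDual (G : SimpleGraph V) [Fintype G.edgeSet] {Q : Type*}
    (l r : G.edgeSet → Q) : Prop :=
  (∀ z : G.edgeSet → ZMod 2, (∀ v, ∑ e with v ∈ e.1, z e = 0) →
    ∃ g : Q → ZMod 2, ∀ e, g (l e) + g (r e) = z e) ∧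
  ∀ (g : Q → ZMod 2) (v : V), ∑ e : G.edgeSet with v ∈ e.1, (g (l e) + g (r e)) = 0

theorem zmod_two_cases (a : ZMod 2) : a = 0 ∨ a = 1 := by
  revert a; decide

omit [Fintype V] in
/-- Every finite abstract dual can be made connected by identifying faces. -/
theorem IsAbstractDual.exists_connected {Q : Type} [Finite Q] {l r : G.edgeSet → Q}
    (h : IsAbstractDual G l r) :
    ∃ (Q' : Type) (_ : Fintype Q') (l' r' : G.edgeSet → Q'), IsAbstractDual G l' r' ∧
      ∀ g : Q' → ZMod 2, (∀ e, g (l' e) + g (r' e) = 0) → ∀ x y, g x = g y := by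
  classical
  induction hm : Nat.card Q using Nat.strong_induction_on generalizing Q with
  | _ m ih =>
  by_cases hc : ∀ g : Q → ZMod 2, (∀ e, g (l e) + g (r e) = 0) → ∀ x y, g x = g y
  · exact ⟨Q, Fintype.ofFinite Q, l, r, h, hc⟩
  push Not at hc
  obtain ⟨g, hg, x, y, hxy⟩ := hc
  let φ : Q → {q : Q // q ≠ y} := fun q =>
    if hq : q = y then ⟨x, fun h => hxy (by rw [h])⟩ else ⟨q, hq⟩
  refine ih (Nat.card {q : Q // q ≠ y}) ?_ (l := φ ∘ l) (r := φ ∘ r) ⟨?_, ?_⟩ rfl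
  · rw [← hm]
    exact Finite.card_subtype_lt (x := y) (by simp)
  · intro z hz
    obtain ⟨g₁, hg₁⟩ := h.1 z hz
    obtain ⟨g₂, hg₂, hy⟩ : ∃ g₂ : Q → ZMod 2, (∀ e, g₂ (l e) + g₂ (r e) = z e) ∧ g₂ x = g₂ y := by
      by_cases hs : g₁ x = g₁ y
      · exact ⟨g₁, hg₁, hs⟩
      · refine ⟨g₁ + g, fun e => ?_, ?_⟩
        · have := hg e
          have := hg₁ e
          simp only [Pi.add_apply]
          linear_combination hg₁ e + hg e
        · simp only [Pi.add_apply]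
          rcases zmod_two_cases (g x) with a | a <;> rcases zmod_two_cases (g y) with b | b <;>
            rcases zmod_two_cases (g₁ x) with c | c <;> rcases zmod_two_cases (g₁ y) with d | d <;>
            rw [a, b] at hxy <;> rw [c, d] at hs <;> rw [a, b, c, d] <;> revert hxy hs <;> decide
    refine ⟨fun q => g₂ q.1, fun e => ?_⟩
    have key : ∀ q, g₂ (φ q).1 = g₂ q := by
      intro q
      by_cases hq : q = y
      · simp [φ, hq, hy]
      · simp [φ, hq]
    simp only [Function.comp, key, hg₂]
  · intro g v
    exact h.2 (g ∘ φ) v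

/-- One half of Euler's formula. -/
theorem IsAbstractDual.card_edges_add_two_le [Nonempty V] {Q : Type} [Fintype Q] [Nonempty Q]
    {l r : G.edgeSet → Q} (h : IsAbstractDual G l r) :
    Fintype.card G.edgeSet + 2 ≤ Fintype.card V + Fintype.card Q := by
  classical
  let cut : (Q → ZMod 2) →ₗ[ZMod 2] (G.edgeSet → ZMod 2) :=
    { toFun := fun g e => g (l e) + g (r e)
      map_add' := by intro a b; ext e; simp only [Pi.add_apply]; ring
      map_smul' := by intro a b; ext e; simp [mul_add] }
  let bd : (G.edgeSet → ZMod 2) →ₗ[ZMod 2] (V → ZMod 2) :=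
    { toFun := fun z v => ∑ e with v ∈ e.1, z e
      map_add' := by intro a b; ext e; simp [Finset.sum_add_distrib]
      map_smul' := by intro a b; ext e; simp [Finset.mul_sum] }
  let tot : (V → ZMod 2) →ₗ[ZMod 2] ZMod 2 :=
    { toFun := fun y => ∑ v, y v
      map_add' := by intro a b; simp [Finset.sum_add_distrib]
      map_smul' := by intro a b; simp [Finset.mul_sum] }
  have h1 : LinearMap.ker bd ≤ LinearMap.range cut := by
    intro z hz
    obtain ⟨g, hg⟩ := h.1 z (fun v => congrFun (LinearMap.mem_ker.1 hz) v)
    exact ⟨g, funext hg⟩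
  have h2 : LinearMap.range bd ≤ LinearMap.ker tot := by
    rintro _ ⟨z, rfl⟩
    rw [LinearMap.mem_ker]
    change ∑ v, ∑ e with v ∈ e.1, z e = 0
    simp only [Finset.sum_filter]
    rw [Finset.sum_comm]
    refine Finset.sum_eq_zero fun e _ => ?_
    obtain ⟨e, he⟩ := e
    induction e with | _ a b
    have hab : a ≠ b := G.ne_of_adj he
    rw [← Finset.sum_filter]
    have : (Finset.univ.filter fun v => v ∈ s(a, b)) = {a, b} := by
      ext v; simp
    simp only [this, Finset.sum_pair hab]
    exact CharTwo.add_self_eq_zero _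
  have r1 := LinearMap.finrank_range_add_finrank_ker cut
  have r2 := LinearMap.finrank_range_add_finrank_ker bd
  have r3 := LinearMap.finrank_range_add_finrank_ker tot
  have m1 := Submodule.finrank_mono h1
  have m2 := Submodule.finrank_mono h2
  have s1 : 1 ≤ Module.finrank (ZMod 2) (LinearMap.ker cut) := by
    rw [Nat.one_le_iff_ne_zero, ← Nat.pos_iff_ne_zero, Module.finrank_pos_iff_exists_ne_zero]
    refine ⟨⟨fun _ => 1, ?_⟩, ?_⟩
    · rw [LinearMap.mem_ker]; ext e; exact CharTwo.add_self_eq_zero _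
    · intro hh
      have := congrFun (congrArg Subtype.val hh) (Classical.arbitrary Q)
      simp at this
  have s2 : Module.finrank (ZMod 2) (LinearMap.range tot) = 1 := by
    rw [LinearMap.range_eq_top.2, finrank_top, Module.finrank_self]
    intro c
    exact ⟨Pi.single (Classical.arbitrary V) c, by simp [tot]⟩
  simp only [Module.finrank_fintype_fun_eq_card] at r1 r2 r3
  omega

omit [Fintype V] [Fintype G.edgeSet] in
/-- In an even edge set, an edge at a vertex is accompanied by another one. -/
theorem exists_adj_ne_of_even {S : Finset G.edgeSet}
    (hS : ∀ v, Even (S.filter fun e => v ∈ e.1).card) {e : G.edgeSet} (he : e ∈ S) {u : V}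
    (hu : u ∈ e.1) : ∃ e' ∈ S, u ∈ e'.1 ∧ e' ≠ e := by
  have hmem : e ∈ S.filter fun e => u ∈ e.1 := by simp [he, hu]
  have hpos := Finset.card_pos.2 ⟨e, hmem⟩
  obtain ⟨m, hm⟩ := hS u
  obtain ⟨e', he', hne⟩ :=
    Finset.exists_mem_ne (s := S.filter fun e => u ∈ e.1) (by omega) e
  simp only [Finset.mem_filter] at he'
  exact ⟨e', he'.1, he'.2, hne⟩

omit [Fintype V] [Fintype G.edgeSet] in
/-- A nonempty even edge set has at least three edges, and if it has exactly three, it is a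
triangle. -/
theorem even_edges_card {S : Finset G.edgeSet}
    (hS : ∀ v, Even (S.filter fun e => v ∈ e.1).card) {u v : V} (huv : G.Adj u v)
    (he : (⟨s(u, v), huv⟩ : G.edgeSet) ∈ S) :
    3 ≤ S.card ∧ (S.card = 3 → ∃ (w : V) (hu : G.Adj u w) (hv : G.Adj v w),
      S = {⟨s(u, v), huv⟩, ⟨s(u, w), hu⟩, ⟨s(v, w), hv⟩}) := by
  obtain ⟨⟨e₁, h₁⟩, h₁S, hu, hne₁⟩ := exists_adj_ne_of_even hS he (u := u) (by simp)
  obtain ⟨⟨e₂, h₂⟩, h₂S, hv, hne₂⟩ := exists_adj_ne_of_even hS he (u := v) (by simp)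
  obtain ⟨w, rfl⟩ := Sym2.mem_iff_exists.1 hu
  obtain ⟨x, rfl⟩ := Sym2.mem_iff_exists.1 hv
  have huw : G.Adj u w := h₁
  have hvx : G.Adj v x := h₂
  have hwv : w ≠ v := by rintro rfl; exact hne₁ rfl
  have hxu : x ≠ u := by rintro rfl; exact hne₂ (Subtype.ext Sym2.eq_swap)
  have huv' := huv.ne
  have h12 : (⟨s(u, w), h₁⟩ : G.edgeSet) ≠ ⟨s(v, x), h₂⟩ := by
    intro h
    have := congrArg Subtype.val h
    simp only [Sym2.eq_iff] at this
    grind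
  have hsub : ({⟨s(u, v), huv⟩, ⟨s(u, w), h₁⟩, ⟨s(v, x), h₂⟩} : Finset G.edgeSet) ⊆ S := by
    intro e; simp only [Finset.mem_insert, Finset.mem_singleton]; grind
  have hc : ({⟨s(u, v), huv⟩, ⟨s(u, w), h₁⟩, ⟨s(v, x), h₂⟩} : Finset G.edgeSet).card = 3 := by
    rw [Finset.card_eq_three]
    exact ⟨_, _, _, hne₁.symm, hne₂.symm, h12, rfl⟩
  refine ⟨hc ▸ Finset.card_le_card hsub, fun h3 => ?_⟩
  have hSe := Finset.eq_of_subset_of_card_le hsub (by omega)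
  obtain ⟨e₃, h₃S, hw, hne₃⟩ := exists_adj_ne_of_even hS h₁S (u := w) (by simp)
  rw [← hSe] at h₃S
  simp only [Finset.mem_insert, Finset.mem_singleton] at h₃S
  have hwu := huw.ne'
  have hxw : x = w := by
    rcases h₃S with rfl | rfl | rfl
    · simp only [Sym2.mem_iff] at hw; grind
    · exact absurd rfl hne₃
    · simp only [Sym2.mem_iff] at hw; grind
  subst hxw
  exact ⟨x, huw, hvx, hSe.symm⟩

theorem containsCopy_theta4 {V : Type*} {G : SimpleGraph V} {u v w x : V} (huv : G.Adj u v)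
    (huw : G.Adj u w) (hvw : G.Adj v w) (hux : G.Adj u x) (hvx : G.Adj v x) (hwx : w ≠ x) :
    ContainsCopy theta4 G := by
  refine ⟨⟨![u, w, v, x], ?_⟩, ?_⟩
  · intro a b hab
    simp only [theta4, fromEdgeSet_adj, Set.mem_insert_iff, Set.mem_singleton_iff, Sym2.eq_iff]
      at hab
    rcases hab.1 with h | h | h | h | h <;> rcases h with ⟨rfl, rfl⟩ | ⟨rfl, rfl⟩ <;>
      simp [huv, huw, hvw, hux, hvx, G.adj_comm]
  · have h1 := huv.ne; have h2 := huw.ne; have h3 := hvw.ne; have h4 := hux.ne; have h5 := hvx.ne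
    intro a b hab
    change ![u, w, v, x] a = ![u, w, v, x] b at hab
    fin_cases a <;> fin_cases b <;> simp at hab ⊢ <;> grind

/-- The density bound for `K₄⁻`-free graphs with an abstract dual. -/
theorem IsAbstractDual.edge_bound {Q : Type} [Finite Q] {l r : G.edgeSet → Q}
    (h : IsAbstractDual G l r) (h4 : ¬ ContainsCopy theta4 G) (hV : 4 ≤ Fintype.card V) :
    5 * Fintype.card G.edgeSet ≤ 12 * (Fintype.card V - 2) := by
  classical
  obtain ⟨Q, _, l, r, h, hconn⟩ := h.exists_connected
  have : Nonempty V := Fintype.card_pos_iff.1 (by omega)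
  rcases isEmpty_or_nonempty Q with hQ | hQ
  · have : IsEmpty G.edgeSet := ⟨fun e => hQ.false (l e)⟩
    simp
  have euler := h.card_edges_add_two_le
  by_cases hQ3 : Fintype.card Q < 3
  · omega
  let B : Q → Finset G.edgeSet := fun q =>
    Finset.univ.filter fun e => (Pi.single q 1 : Q → ZMod 2) (l e) +
      (Pi.single q 1 : Q → ZMod 2) (r e) ≠ 0
  have hBmem : ∀ q e, e ∈ B q ↔ ((l e = q) ↔ ¬ (r e = q)) := by
    intro q e
    simp only [B, Finset.mem_filter, Finset.mem_univ, true_and, Pi.single_apply]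
    by_cases h1 : l e = q <;> by_cases h2 : r e = q <;> (simp [h1, h2]; try decide)
  have heven : ∀ q v, Even ((B q).filter fun e => v ∈ e.1).card := by
    intro q v
    have h0 := h.2 (Pi.single q 1) v
    rw [← ZMod.natCast_eq_zero_iff_even, ← h0, Finset.card_eq_sum_ones, Nat.cast_sum,
      Finset.filter_filter, Finset.filter_congr (fun e _ => and_comm), ← Finset.filter_filter,
      Finset.sum_filter (s := Finset.univ.filter fun e : G.edgeSet => v ∈ e.1)]
    refine Finset.sum_congr rfl fun e _ => ?_
    rcases zmod_two_cases ((Pi.single q 1 : Q → ZMod 2) (l e) + (Pi.single q 1 : Q → ZMod 2) (r e))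
      with h | h <;> simp [h]
  have hne : ∀ q, (B q).Nonempty := by
    intro q
    by_contra hq
    obtain ⟨q', hq'⟩ := Finset.exists_mem_ne (s := Finset.univ) (by rw [Finset.card_univ]; omega) q
    have := hconn (Pi.single q 1) (fun e => by
      by_contra he
      exact hq ⟨e, by simp only [B, Finset.mem_filter]; exact ⟨Finset.mem_univ _, he⟩⟩) q q'
    simp [hq'.2] at this
  have hinj : ∀ q q', q ≠ q' → B q ≠ B q' := by
    intro q q' hqq hB
    obtain ⟨q'', hq''⟩ : ∃ q'', q'' ∉ ({q, q'} : Finset Q) := by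
      by_contra hcon
      push Not at hcon
      have := Finset.card_le_card (fun x _ => hcon x : Finset.univ ⊆ _)
      have := Finset.card_le_two (a := q) (b := q')
      rw [Finset.card_univ] at *
      omega
    simp only [Finset.mem_insert, Finset.mem_singleton, not_or] at hq''
    have := hconn (Pi.single q 1 + Pi.single q' 1) (fun e => by
      have h1 := hBmem q e
      have h2 := hBmem q' e
      rw [hB] at h1
      simp only [Pi.add_apply, Pi.single_apply]
      by_cases a1 : l e = q <;> by_cases a2 : r e = q <;> by_cases a3 : l e = q' <;>
        by_cases a4 : r e = q' <;> simp [a1, a2, a3, a4] at h1 h2 ⊢ <;>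
            first | decide | grind) q q''
    simp [hq''.1, hq''.2, hqq] at this
  have hcard3 : ∀ q, 3 ≤ (B q).card := by
    intro q
    obtain ⟨⟨e, he⟩, heB⟩ := hne q
    induction e with | _ a b
    exact (even_edges_card (heven q) he heB).1
  let T := Finset.univ.filter fun q => (B q).card = 3
  have hdisj : ∀ q ∈ T, ∀ q' ∈ T, q ≠ q' → Disjoint (B q) (B q') := by
    intro q hq q' hq' hqq
    rw [Finset.disjoint_left]
    rintro ⟨e, he⟩ h1 h2
    induction e with | _ a b
    simp only [T, Finset.mem_filter, Finset.mem_univ, true_and] at hq hq'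
    obtain ⟨w, hu, hv, hS⟩ := (even_edges_card (heven q) he h1).2 hq
    obtain ⟨w', hu', hv', hS'⟩ := (even_edges_card (heven q') he h2).2 hq'
    by_cases hw : w = w'
    · subst hw
      exact hinj q q' hqq (hS.trans hS'.symm)
    · exact h4 (containsCopy_theta4 he hu hv hu' hv' hw)
  have hT : 3 * T.card ≤ Fintype.card G.edgeSet := by
    have h1 := Finset.card_biUnion hdisj
    have h2 : ∑ q ∈ T, (B q).card = ∑ q ∈ T, 3 := Finset.sum_congr rfl fun q hq => by
      simpa [T] using hq
    have h3 := Finset.card_le_univ (T.biUnion B)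
    rw [h1, h2, Finset.sum_const, smul_eq_mul] at h3
    omega
  have hsum : ∑ q, (B q).card ≤ 2 * Fintype.card G.edgeSet := by
    have : ∑ q, (B q).card = ∑ e : G.edgeSet, (Finset.univ.filter fun q => e ∈ B q).card := by
      simp only [Finset.card_filter]
      rw [Finset.sum_comm]
      refine Finset.sum_congr rfl fun q _ => ?_
      rw [← Finset.card_filter]
      congr 1
      ext; simp
    rw [this, mul_comm, ← smul_eq_mul, ← Finset.card_univ]
    refine Finset.sum_le_card_nsmul _ _ _ fun e _ => ?_
    refine (Finset.card_le_card (t := {l e, r e}) fun q hq => ?_).trans Finset.card_le_two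
    simp only [Finset.mem_filter, hBmem] at hq
    simp only [Finset.mem_insert, Finset.mem_singleton]
    grind
  have hlow : 4 * Fintype.card Q ≤ ∑ q, (B q).card + T.card := by
    rw [Finset.card_filter, ← Finset.sum_add_distrib, mul_comm, ← smul_eq_mul, ← Finset.card_univ]
    refine Finset.card_nsmul_le_sum _ _ _ fun q _ => ?_
    have := hcard3 q
    split_ifs <;> omega
  omega

end AbstractDual

section Grid

/-- The four unit steps of the square grid `ℤ × ℤ`. -/
def gridStep : Fin 4 → ℤ × ℤ := ![(1, 0), (-1, 0), (0, 1), (0, -1)]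

/-- The direction opposite to a given one. -/
def gridRev : Fin 4 → Fin 4 := ![1, 0, 3, 2]

/-- Offset of the first of the two squares at a grid edge; a square is named by its lower left
corner. -/
def gridFaceA : Fin 4 → ℤ × ℤ := ![(0, 0), (-1, 0), (0, 0), (0, -1)]

/-- Offset of the second of the two squares at a grid edge. -/
def gridFaceB : Fin 4 → ℤ × ℤ := ![(0, -1), (-1, -1), (-1, 0), (-1, -1)]

/-- Adjacency in the square grid. -/
def GridAdj (p q : ℤ × ℤ) : Prop := ∃ d, q = p + gridStep d

theorem gridStep_injective : Function.Injective gridStep := by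
  decide

theorem gridStep_ne_zero (d : Fin 4) : gridStep d ≠ 0 := by
  revert d; decide

theorem add_gridStep_rev (p : ℤ × ℤ) (d : Fin 4) : p + gridStep d + gridStep (gridRev d) = p := by
  have : gridStep d + gridStep (gridRev d) = 0 := by revert d; decide
  rw [add_assoc, this, add_zero]

theorem gridRev_rev (d : Fin 4) : gridRev (gridRev d) = d := by
  revert d; decide

theorem gridStep_add_faceA_rev (p : ℤ × ℤ) (d : Fin 4) :
    p + gridStep d + gridFaceA (gridRev d) = p + gridFaceA d := by
  have : gridStep d + gridFaceA (gridRev d) = gridFaceA d := by revert d; decide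
  rw [add_assoc, this]

theorem gridStep_add_faceB_rev (p : ℤ × ℤ) (d : Fin 4) :
    p + gridStep d + gridFaceB (gridRev d) = p + gridFaceB d := by
  have : gridStep d + gridFaceB (gridRev d) = gridFaceB d := by revert d; decide
  rw [add_assoc, this]

theorem GridAdj.symm {p q : ℤ × ℤ} (h : GridAdj p q) : GridAdj q p := by
  obtain ⟨d, rfl⟩ := h
  exact ⟨gridRev d, (add_gridStep_rev p d).symm⟩

/-- The mod 2 boundary of a chain of grid edges. -/
def gridBoundary (c : Sym2 (ℤ × ℤ) → ZMod 2) (p : ℤ × ℤ) : ZMod 2 :=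
  ∑ d, c s(p, p + gridStep d)

theorem int_eq_of_eq_sub_one {α : Type*} {f : ℤ → α} (h : ∀ i, f i = f (i - 1)) (i : ℤ) :
    f i = f 0 := by
  induction i using Int.induction_on with
  | zero => rfl
  | succ i ih => rw [h, add_sub_cancel_right, ih]
  | pred i ih => rw [← h, ih]

theorem exists_int_primitive (f : ℤ → ZMod 2) :
    ∃ F : ℤ → ZMod 2, F 0 = 0 ∧ ∀ i, F i = F (i - 1) + f i := by
  refine ⟨fun i => ∑ j ∈ Finset.Ioc 0 i, f j + ∑ j ∈ Finset.Ioc i 0, f j, by simp, fun i => ?_⟩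
  rcases lt_or_ge 0 i with hi | hi
  · have h1 : Finset.Ioc 0 i = insert i (Finset.Ioc 0 (i - 1)) := by
      ext j; simp only [Finset.mem_Ioc, Finset.mem_insert]; omega
    have h2 : Finset.Ioc i 0 = ∅ := Finset.Ioc_eq_empty (by omega)
    have h3 : Finset.Ioc (i - 1) 0 = ∅ := Finset.Ioc_eq_empty (by omega)
    beta_reduce
    rw [h1, h2, h3, Finset.sum_insert (by simp)]
    simp [add_comm]
  · have h1 : Finset.Ioc (i - 1) 0 = insert i (Finset.Ioc i 0) := by
      ext j; simp only [Finset.mem_Ioc, Finset.mem_insert]; omega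
    have h2 : Finset.Ioc 0 i = ∅ := Finset.Ioc_eq_empty (by omega)
    have h3 : Finset.Ioc 0 (i - 1) = ∅ := Finset.Ioc_eq_empty (by omega)
    beta_reduce
    rw [h1, h2, h3, Finset.sum_insert (by simp), Finset.sum_empty, zero_add, zero_add,
      add_comm (f i), add_assoc, CharTwo.add_self_eq_zero, add_zero]

/-- The grid is simply connected: every closed chain is the coboundary of a function on squares. -/
theorem exists_grid_potential {c : Sym2 (ℤ × ℤ) → ZMod 2} (hc : ∀ p, gridBoundary c p = 0) :
    ∃ g : ℤ × ℤ → ZMod 2, ∀ p d,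
      g (p + gridFaceA d) + g (p + gridFaceB d) = c s(p, p + gridStep d) := by
  let hh : ℤ → ℤ → ZMod 2 := fun i j => c s((i, j), (i + 1, j))
  let vv : ℤ → ℤ → ZMod 2 := fun i j => c s((i, j), (i, j + 1))
  have hcl : ∀ i j, hh i j + hh (i - 1) j + vv i j + vv i (j - 1) = 0 := by
    intro i j
    have := hc (i, j)
    simp only [gridBoundary, Fin.sum_univ_four, gridStep, Matrix.cons_val, Prod.mk_add_mk, add_zero,
      ← sub_eq_add_neg] at this
    simp only [hh, vv, sub_add_cancel]
    rw [Sym2.eq_swap (a := (i - 1, j)), Sym2.eq_swap (a := (i, j - 1))]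
    exact this
  choose F hF0 hF using fun j => exists_int_primitive fun i => vv i j
  obtain ⟨K, -, hK⟩ := exists_int_primitive fun j => hh 0 j
  have hD : ∀ i j, F j i + F (j - 1) i + hh i j = hh 0 j := by
    intro i j
    have := int_eq_of_eq_sub_one (f := fun i => F j i + F (j - 1) i + hh i j) (fun i => by
      have h1 := hF j i
      have h2 := hF (j - 1) i
      have h3 := hcl i j
      have h4 : hh (i - 1) j + hh (i - 1) j = 0 := CharTwo.add_self_eq_zero _
      linear_combination h1 + h2 + h3 - h4) i
    simpa [hF0] using this
  let g : ℤ × ℤ → ZMod 2 := fun p => F p.2 p.1 + K p.2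
  have gh : ∀ i j, g (i, j) + g (i, j - 1) = hh i j := by
    intro i j
    have h1 := hD i j
    have h2 := hK j
    have h3 : hh i j + hh i j = 0 := CharTwo.add_self_eq_zero _
    have h4 : hh 0 j + hh 0 j = 0 := CharTwo.add_self_eq_zero _
    have h5 : K (j - 1) + K (j - 1) = 0 := CharTwo.add_self_eq_zero _
    simp only [g]
    linear_combination h1 + h2 - h3 + h4 + h5
  have gv : ∀ i j, g (i, j) + g (i - 1, j) = vv i j := by
    intro i j
    have h1 := hF j i
    have h4 : K j + K j = 0 := CharTwo.add_self_eq_zero _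
    have h5 : F j (i - 1) + F j (i - 1) = 0 := CharTwo.add_self_eq_zero _
    simp only [g]
    linear_combination h1 + h4 + h5
  refine ⟨g, ?_⟩
  rintro ⟨i, j⟩ d
  fin_cases d
  · simpa [gridFaceA, gridFaceB, gridStep, sub_eq_add_neg] using gh i j
  · have := gh (i - 1) j
    simp only [hh, sub_add_cancel] at this
    rw [Sym2.eq_swap] at this
    simpa [gridFaceA, gridFaceB, gridStep, sub_eq_add_neg] using this
  · simpa [gridFaceA, gridFaceB, gridStep, sub_eq_add_neg] using gv i j
  · have := gv i (j - 1)
    simp only [vv, sub_add_cancel] at this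
    rw [Sym2.eq_swap] at this
    simpa [gridFaceA, gridFaceB, gridStep, sub_eq_add_neg] using this

theorem grid_coboundary_closed (g : ℤ × ℤ → ZMod 2) (p : ℤ × ℤ) :
    ∑ d, (g (p + gridFaceA d) + g (p + gridFaceB d)) = 0 := by
  obtain ⟨i, j⟩ := p
  simp only [Fin.sum_univ_four, gridFaceA, gridFaceB, Matrix.cons_val, Prod.mk_add_mk, add_zero]
  generalize g (i, j) = a
  generalize g (i, j + -1) = b
  generalize g (i + -1, j) = c
  generalize g (i + -1, j + -1) = d
  revert a b c d
  decide

theorem gridBoundary_single (p : ℤ × ℤ) (d : Fin 4) (r : ℤ × ℤ) :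
    gridBoundary (Pi.single s(p, p + gridStep d) 1) r =
      (Pi.single p 1 : ℤ × ℤ → ZMod 2) r + (Pi.single (p + gridStep d) 1 : ℤ × ℤ → ZMod 2) r := by
  have hne : p ≠ p + gridStep d := fun h => gridStep_ne_zero d (by simpa using h)
  simp only [gridBoundary, Pi.single_apply]
  by_cases h1 : r = p
  · subst h1
    rw [if_pos rfl, if_neg hne, add_zero, Finset.sum_eq_single d]
    · simp
    · intro d' _ hd'
      rw [if_neg]
      rw [Sym2.eq_iff]
      rintro (⟨-, h⟩ | ⟨h, -⟩)
      · exact hd' (gridStep_injective (add_left_cancel h))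
      · exact hne h
    · simp
  by_cases h2 : r = p + gridStep d
  · rw [if_neg h1, if_pos h2, zero_add, Finset.sum_eq_single (gridRev d)]
    · rw [if_pos]
      rw [h2, add_gridStep_rev, Sym2.eq_swap]
    · intro d' _ hd'
      rw [if_neg]
      rw [Sym2.eq_iff]
      rintro (⟨h, -⟩ | ⟨-, h⟩)
      · exact h1 h
      · rw [h2] at h
        exact hd' (gridStep_injective (add_left_cancel (h.trans (add_gridStep_rev p d).symm)))
    · simp
  · rw [if_neg h1, if_neg h2, add_zero]
    refine Finset.sum_eq_zero fun d' _ => if_neg ?_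
    rw [Sym2.eq_iff]
    rintro (⟨h, -⟩ | ⟨h, -⟩)
    · exact h1 h
    · exact h2 h

theorem gridBoundary_add (c c' : Sym2 (ℤ × ℤ) → ZMod 2) (r : ℤ × ℤ) :
    gridBoundary (c + c') r = gridBoundary c r + gridBoundary c' r := by
  simp [gridBoundary, Finset.sum_add_distrib]

/-- Two points of a connected fiber of a labelling are joined by a chain inside the fiber. -/
theorem exists_chain_of_connected {L : Type*} {β : ℤ × ℤ → L} {x : L} {p q : ℤ × ℤ}
    (hp : β p = x) (h : Relation.ReflTransGen (fun a b => GridAdj a b ∧ β b = x) p q) :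
    β q = x ∧ ∃ c : Sym2 (ℤ × ℤ) → ZMod 2, (∀ e, c e ≠ 0 → Sym2.map β e = s(x, x)) ∧
      ∀ r, gridBoundary c r =
        (Pi.single p 1 : ℤ × ℤ → ZMod 2) r + (Pi.single q 1 : ℤ × ℤ → ZMod 2) r := by
  induction h with
  | refl =>
    exact ⟨hp, 0, by simp, fun r => by simp [gridBoundary, CharTwo.add_self_eq_zero]⟩
  | @tail b b' _ hbb ih =>
    obtain ⟨hb, c, hc, hcb⟩ := ih
    obtain ⟨⟨d, rfl⟩, hb'⟩ := hbb
    refine ⟨hb', c + Pi.single s(b, b + gridStep d) 1, fun e he => ?_, fun r => ?_⟩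
    · by_cases h0 : c e = 0
      · simp only [Pi.add_apply, h0, zero_add, Pi.single_apply] at he
        have : e = s(b, b + gridStep d) := by by_contra hne; simp [hne] at he
        rw [this, Sym2.map_mk, hb, hb']
      · exact hc e h0
    · have h2 := CharTwo.add_self_eq_zero ((Pi.single b 1 : ℤ × ℤ → ZMod 2) r)
      rw [gridBoundary_add, hcb, gridBoundary_single]
      linear_combination h2

/-- The coboundary of a function on squares has zero total over the grid edges leaving a finite
set. -/
theorem sum_leaving_eq_zero (g : ℤ × ℤ → ZMod 2) (S : Finset (ℤ × ℤ)) :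
    ∑ x ∈ (S ×ˢ (Finset.univ : Finset (Fin 4))).filter (fun x => x.1 + gridStep x.2 ∉ S),
      (g (x.1 + gridFaceA x.2) + g (x.1 + gridFaceB x.2)) = 0 := by
  have h1 : ∑ x ∈ S ×ˢ (Finset.univ : Finset (Fin 4)),
      (g (x.1 + gridFaceA x.2) + g (x.1 + gridFaceB x.2)) = 0 := by
    rw [Finset.sum_product]
    exact Finset.sum_eq_zero fun p _ => grid_coboundary_closed g p
  have h2 : ∑ x ∈ (S ×ˢ (Finset.univ : Finset (Fin 4))).filter (fun x => x.1 + gridStep x.2 ∈ S),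
      (g (x.1 + gridFaceA x.2) + g (x.1 + gridFaceB x.2)) = 0 := by
    refine Finset.sum_involution (fun x _ => (x.1 + gridStep x.2, gridRev x.2)) ?_ ?_ ?_ ?_
    · intro x _
      simp only [gridStep_add_faceA_rev, gridStep_add_faceB_rev]
      exact CharTwo.add_self_eq_zero _
    · rintro x - - h
      exact gridStep_ne_zero x.2 (by simpa using congrArg Prod.fst h)
    · intro x hx
      simp only [Finset.mem_filter, Finset.mem_product, Finset.mem_univ, and_true] at hx ⊢
      rw [add_gridStep_rev]
      exact hx.symm
    · intro x _
      simp [add_gridStep_rev, gridRev_rev]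
  rw [← Finset.sum_filter_add_sum_filter_not _ (fun x => x.1 + gridStep x.2 ∈ S), h2,
    zero_add] at h1
  exact h1

end Grid

section GridModel

variable {V : Type*} [Fintype V] [DecidableEq V] {G : SimpleGraph V} [Fintype G.edgeSet]

omit [Fintype G.edgeSet] in
theorem sum_ends (e : G.edgeSet) (f : V → ZMod 2) {u v : V} (h : e.1 = s(u, v)) :
    ∑ w with w ∈ e.1, f w = f u + f v := by
  have huv : u ≠ v := G.ne_of_adj (by rw [← G.mem_edgeSet, ← h]; exact e.2)
  have : (Finset.univ.filter fun w => w ∈ e.1) = {u, v} := by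
    ext w; simp [h]
  rw [this, Finset.sum_pair huv]

/-- A labelling of the grid in which the points labelled by a given vertex or edge of `G` form a
finite connected set, and the sets of an edge and its ends touch, yields an abstract dual of `G`
made of unions of grid squares. -/
theorem exists_isAbstractDual_of_grid (β : ℤ × ℤ → Option (V ⊕ G.edgeSet))
    (hfin : ∀ x, {p | β p = some x}.Finite)
    (hne : ∀ x, ∃ p, β p = some x)
    (hconn : ∀ x p q, β p = some x → β q = some x →
      Relation.ReflTransGen (fun a b => GridAdj a b ∧ β b = some x) p q)
    (hatt : ∀ (e : G.edgeSet) (v : V), v ∈ e.1 →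
      ∃ p d, β p = some (Sum.inl v) ∧ β (p + gridStep d) = some (Sum.inr e)) :
    ∃ (Q : Type) (l r : G.edgeSet → Q), IsAbstractDual G l r := by
  classical
  have hatt' : ∀ (e : G.edgeSet) (v : V), ∃ p d, v ∈ e.1 →
      β p = some (Sum.inl v) ∧ β (p + gridStep d) = some (Sum.inr e) := by
    intro e v
    by_cases h : v ∈ e.1
    · obtain ⟨p, d, h⟩ := hatt e v h
      exact ⟨p, d, fun _ => h⟩
    · exact ⟨0, 0, fun h' => absurd h' h⟩
  choose P D hPD using hatt'
  choose base hbase using hne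
  let A : G.edgeSet → V → Sym2 (ℤ × ℤ) := fun e v => s(P e v, P e v + gridStep (D e v))
  have hA : ∀ e v, v ∈ e.1 →
      Sym2.map β (A e v) = s(some (Sum.inl v), some (Sum.inr e)) := by
    intro e v h
    rw [Sym2.map_mk, (hPD e v h).1, (hPD e v h).2]
  have hAinj : ∀ e v e' v', v ∈ e.1 → v' ∈ e'.1 → A e v = A e' v' → e = e' ∧ v = v' := by
    intro e v e' v' h h' hh
    have := (hA e v h).symm.trans ((congrArg _ hh).trans (hA e' v' h'))
    simp only [Sym2.eq_iff] at this
    simp at this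
    exact this.symm
  let free : ℤ × ℤ → Fin 4 → Prop := fun p d =>
    β p ≠ β (p + gridStep d) ∧ ∀ e v, v ∈ e.1 → s(p, p + gridStep d) ≠ A e v
  let R : ℤ × ℤ → ℤ × ℤ → Prop := fun x y =>
    ∃ p d, free p d ∧ x = p + gridFaceA d ∧ y = p + gridFaceB d
  let Q := Quot R
  let end₁ : G.edgeSet → V := fun e => (Quot.out e.1).1
  have hend : ∀ e, end₁ e ∈ e.1 := fun e => Sym2.out_fst_mem e.1
  refine ⟨Q, fun e => Quot.mk R (P e (end₁ e) + gridFaceA (D e (end₁ e))),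
    fun e => Quot.mk R (P e (end₁ e) + gridFaceB (D e (end₁ e))), ?_, ?_⟩
  · intro z hz
    have hchain : ∀ (e : G.edgeSet) (v : V), ∃ c : Sym2 (ℤ × ℤ) → ZMod 2, v ∈ e.1 →
        (∀ p d, free p d → c s(p, p + gridStep d) = 0) ∧
        (∀ e' v', v' ∈ e'.1 → c (A e' v') = if e = e' ∧ v = v' then 1 else 0) ∧
        ∀ q, gridBoundary c q = (Pi.single (base (Sum.inl v)) 1 : ℤ × ℤ → ZMod 2) q +
          (Pi.single (base (Sum.inr e)) 1 : ℤ × ℤ → ZMod 2) q := by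
      intro e v
      by_cases h : v ∈ e.1
      swap
      · exact ⟨0, fun h' => absurd h' h⟩
      obtain ⟨-, c₁, h₁, hb₁⟩ := exists_chain_of_connected (hbase (Sum.inl v))
        (hconn _ _ _ (hbase (Sum.inl v)) (hPD e v h).1)
      obtain ⟨-, c₂, h₂, hb₂⟩ := exists_chain_of_connected (hPD e v h).2
        (hconn _ _ _ (hPD e v h).2 (hbase (Sum.inr e)))
      refine ⟨c₁ + Pi.single (A e v) 1 + c₂, fun _ => ⟨?_, ?_, ?_⟩⟩
      · intro p d hf
        have z₁ : c₁ s(p, p + gridStep d) = 0 := by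
          by_contra h0
          have := h₁ _ h0
          rw [Sym2.map_mk, Sym2.eq_iff] at this
          exact hf.1 (by grind)
        have z₂ : c₂ s(p, p + gridStep d) = 0 := by
          by_contra h0
          have := h₂ _ h0
          rw [Sym2.map_mk, Sym2.eq_iff] at this
          exact hf.1 (by grind)
        simp [z₁, z₂, hf.2 e v h]
      · intro e' v' h'
        have z₁ : c₁ (A e' v') = 0 := by
          by_contra h0
          have := h₁ _ h0
          rw [hA e' v' h', Sym2.eq_iff] at this
          simp at this
        have z₂ : c₂ (A e' v') = 0 := by
          by_contra h0
          have := h₂ _ h0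
          rw [hA e' v' h', Sym2.eq_iff] at this
          simp at this
        simp only [Pi.add_apply, z₁, z₂, Pi.single_apply, zero_add, add_zero]
        congr 1
        refine propext ⟨fun hh => ?_, ?_⟩
        · exact (hAinj _ _ _ _ h h' hh.symm)
        · rintro ⟨rfl, rfl⟩; rfl
      · intro q
        rw [gridBoundary_add, gridBoundary_add, hb₁, hb₂, gridBoundary_single]
        have e₁ := CharTwo.add_self_eq_zero ((Pi.single (P e v) 1 : ℤ × ℤ → ZMod 2) q)
        have e₂ := CharTwo.add_self_eq_zero
          ((Pi.single (P e v + gridStep (D e v)) 1 : ℤ × ℤ → ZMod 2) q)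
        linear_combination e₁ + e₂
    choose C hC using hchain
    let c : Sym2 (ℤ × ℤ) → ZMod 2 := fun ε => ∑ e, ∑ v with v ∈ e.1, z e * C e v ε
    have hcb : ∀ p, gridBoundary c p = 0 := by
      intro p
      have h1 : gridBoundary c p = ∑ e, ∑ v with v ∈ e.1, z e * gridBoundary (C e v) p := by
        simp only [gridBoundary, c, Finset.mul_sum]
        rw [Finset.sum_comm]
        exact Finset.sum_congr rfl fun e _ => Finset.sum_comm
      have h2 : ∀ e : G.edgeSet, ∑ v with v ∈ e.1, z e * gridBoundary (C e v) p =
          ∑ v with v ∈ e.1, z e * (Pi.single (base (Sum.inl v)) 1 : ℤ × ℤ → ZMod 2) p := by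
        intro e
        have h3 : ∀ v ∈ Finset.univ.filter (fun v => v ∈ e.1), z e * gridBoundary (C e v) p =
            z e * (Pi.single (base (Sum.inl v)) 1 : ℤ × ℤ → ZMod 2) p +
            z e * (Pi.single (base (Sum.inr e)) 1 : ℤ × ℤ → ZMod 2) p := by
          intro v hv
          rw [(hC e v (by simpa using hv)).2.2, mul_add]
        rw [Finset.sum_congr rfl h3, Finset.sum_add_distrib]
        obtain ⟨⟨u, v⟩, huv⟩ := Quot.exists_rep e.1
        rw [sum_ends e _ huv.symm, sum_ends e _ huv.symm,
          CharTwo.add_self_eq_zero (z e * (Pi.single (base (Sum.inr e)) 1 : ℤ × ℤ → ZMod 2) p),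
          add_zero]
      rw [h1, Finset.sum_congr rfl fun e _ => h2 e]
      simp only [Finset.sum_filter]
      rw [Finset.sum_comm]
      refine Finset.sum_eq_zero fun v _ => ?_
      rw [← Finset.sum_filter, ← Finset.sum_mul, hz, zero_mul]
    obtain ⟨g, hg⟩ := exists_grid_potential hcb
    refine ⟨Quot.lift g ?_, ?_⟩
    · rintro _ _ ⟨p, d, hf, rfl, rfl⟩
      rw [← CharTwo.add_eq_zero, hg]
      refine Finset.sum_eq_zero fun e _ => Finset.sum_eq_zero fun v hv => ?_
      rw [(hC e v (by simpa using hv)).1 p d hf, mul_zero]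
    · intro e
      simp only [hg]
      change c (A e (end₁ e)) = z e
      simp only [c]
      rw [Finset.sum_eq_single e, Finset.sum_eq_single (end₁ e)]
      · rw [(hC e _ (hend e)).2.1 e _ (hend e)]; simp
      · intro v hv hne
        rw [(hC e v (by simpa using hv)).2.1 e _ (hend e)]; simp [hne]
      · simp [hend]
      · intro e' _ hne
        refine Finset.sum_eq_zero fun v hv => ?_
        rw [(hC e' v (by simpa using hv)).2.1 e _ (hend e)]; simp [hne]
      · simp
  · intro g v
    let f : ℤ × ℤ → ZMod 2 := fun x => g (Quot.mk R x)
    let zz : ℤ × ℤ → Fin 4 → ZMod 2 := fun p d => f (p + gridFaceA d) + f (p + gridFaceB d)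
    have hzz : ∀ p d, free p d → zz p d = 0 := by
      intro p d hf
      have : f (p + gridFaceA d) = f (p + gridFaceB d) :=
        congrArg g (Quot.sound ⟨p, d, hf, rfl, rfl⟩)
      simp only [zz, this]
      exact CharTwo.add_self_eq_zero _
    have hnf : ∀ p d, β p ≠ β (p + gridStep d) → zz p d ≠ 0 →
        ∃ e v, v ∈ e.1 ∧ s(p, p + gridStep d) = A e v := by
      intro p d hβ hnz
      by_contra hcon
      push Not at hcon
      exact hnz (hzz p d ⟨hβ, hcon⟩)
    have hsum : ∀ x, ∑ y ∈ ((hfin x).toFinset ×ˢ (Finset.univ : Finset (Fin 4))).filter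
        (fun y => β (y.1 + gridStep y.2) ≠ some x), zz y.1 y.2 = 0 := by
      intro x
      have := sum_leaving_eq_zero f (hfin x).toFinset
      simpa using this
    have hX : ∀ (e : G.edgeSet) (u w : V), u ∈ e.1 → w ∈ e.1 →
        zz (P e u) (D e u) = zz (P e w) (D e w) := by
      have main : ∀ e : G.edgeSet, ∑ u with u ∈ e.1, zz (P e u) (D e u) = 0 := by
        intro e
        rw [← hsum (Sum.inr e)]
        refine Finset.sum_bij_ne_zero
          (fun u _ _ => (P e u + gridStep (D e u), gridRev (D e u))) ?_ ?_ ?_ ?_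
        · intro u hu _
          have := hPD e u (by simpa using hu)
          simp [add_gridStep_rev, this.1, this.2]
        · intro u hu _ u' hu' _ h
          simp only [Finset.mem_filter, Finset.mem_univ, true_and] at hu hu'
          refine (hAinj e u e u' hu hu' ?_).2
          simp only [Prod.mk.injEq] at h
          have hD : D e u = D e u' := by rw [← gridRev_rev (D e u), h.2, gridRev_rev]
          have hP : P e u = P e u' := by
            have := h.1
            rw [hD] at this
            exact add_right_cancel this
          simp only [A, hD, hP]
        · rintro ⟨p, d⟩ hp hnz
          simp only [Finset.mem_filter, Finset.mem_product, Set.Finite.mem_toFinset,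
            Set.mem_ofPred_eq, Finset.mem_univ, and_true] at hp hnz
          obtain ⟨e', u, hu, he'⟩ := hnf p d (by rw [hp.1]; exact hp.2.symm) hnz
          have hm := hA e' u hu
          rw [← he', Sym2.map_mk, hp.1, Sym2.eq_iff] at hm
          simp at hm
          obtain ⟨rfl, hm⟩ := hm
          simp only [A, Sym2.eq_iff] at he'
          rcases he' with ⟨h1, h2⟩ | ⟨h1, h2⟩
          · rw [h1, (hPD e u hu).1] at hp
            simp at hp
          · have hd : d = gridRev (D e u) := by
              apply gridStep_injective
              refine add_left_cancel (a := p) ?_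
              rw [h2, h1, add_gridStep_rev]
            refine ⟨u, by simpa using hu, ?_, by rw [h1, hd]⟩
            simp only [zz, h1, hd, gridStep_add_faceA_rev, gridStep_add_faceB_rev] at hnz
            exact hnz
        · intro u _ _
          simp only [zz, gridStep_add_faceA_rev, gridStep_add_faceB_rev]
      intro e u w hu hw
      by_cases huw : u = w
      · rw [huw]
      · have := main e
        rw [sum_ends e _ ((Sym2.mem_and_mem_iff huw).1 ⟨hu, hw⟩)] at this
        exact CharTwo.add_eq_zero.1 this
    change ∑ e : G.edgeSet with v ∈ e.1, zz (P e (end₁ e)) (D e (end₁ e)) = 0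
    rw [← hsum (Sum.inl v), Finset.sum_congr rfl fun e he =>
      hX e (end₁ e) v (hend e) (by simpa using he)]
    refine Finset.sum_bij_ne_zero (fun e _ _ => (P e v, D e v)) ?_ ?_ ?_ ?_
    · intro e he _
      have := hPD e v (by simpa using he)
      simp [this.1, this.2]
    · intro e he _ e' he' _ h
      simp only [Finset.mem_filter, Finset.mem_univ, true_and] at he he'
      refine (hAinj e v e' v he he' ?_).1
      simp only [Prod.mk.injEq] at h
      simp only [A, h.1, h.2]
    · rintro ⟨p, d⟩ hp hnz
      simp only [Finset.mem_filter, Finset.mem_product, Set.Finite.mem_toFinset,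
        Set.mem_ofPred_eq, Finset.mem_univ, and_true] at hp hnz
      obtain ⟨e, u, hu, he'⟩ := hnf p d (by rw [hp.1]; exact hp.2.symm) hnz
      have hm := hA e u hu
      rw [← he', Sym2.map_mk, hp.1, Sym2.eq_iff] at hm
      simp at hm
      obtain ⟨rfl, hm⟩ := hm
      simp only [A, Sym2.eq_iff] at he'
      rcases he' with ⟨h1, h2⟩ | ⟨h1, h2⟩
      · have hd : d = D e v := by
          apply gridStep_injective
          rw [h1] at h2
          exact add_left_cancel h2
        exact ⟨e, by simpa using hu, by rw [← h1, ← hd]; exact hnz, by rw [← h1, ← hd]⟩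
      · rw [h1, (hPD e v hu).2] at hp
        simp at hp
    · intro e _ _
      rfl

end GridModel

section Discretization

theorem reach_mem {S : Set (ℤ × ℤ)} {p q : ℤ × ℤ} (hp : p ∈ S)
    (h : Relation.ReflTransGen (fun a b => GridAdj a b ∧ b ∈ S) p q) : q ∈ S := by
  induction h with
  | refl => exact hp
  | tail _ h _ => exact h.2

theorem reach_symm {S : Set (ℤ × ℤ)} {p q : ℤ × ℤ} (hp : p ∈ S)
    (h : Relation.ReflTransGen (fun a b => GridAdj a b ∧ b ∈ S) p q) :
    Relation.ReflTransGen (fun a b => GridAdj a b ∧ b ∈ S) q p := by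
  induction h with
  | refl => exact .refl
  | tail h h' ih => exact .head ⟨h'.1.symm, reach_mem hp h⟩ ih

/-- A path in the grid from `X` to `Y` inside `N` yields a connected set touching `X` and `Y` and
otherwise avoiding them. -/
theorem exists_connector {N X Y : Set (ℤ × ℤ)} (hXY : Disjoint X Y)
    (hadj : ∀ x ∈ X, ∀ y ∈ Y, ¬ GridAdj x y) {p q : ℤ × ℤ} (hpX : p ∈ X) (hqY : q ∈ Y)
    (hpq : Relation.ReflTransGen (fun a b => GridAdj a b ∧ b ∈ N) p q) :
    ∃ B : Set (ℤ × ℤ), (∀ b ∈ B, b ∈ N ∧ b ∉ X ∧ b ∉ Y) ∧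
      (∀ a ∈ B, ∀ b ∈ B, Relation.ReflTransGen (fun a b => GridAdj a b ∧ b ∈ B) a b) ∧
      (∃ x ∈ X, ∃ b ∈ B, GridAdj x b) ∧ ∃ y ∈ Y, ∃ b ∈ B, GridAdj y b := by
  let N' : Set (ℤ × ℤ) := {b | b ∈ N ∧ b ∉ X ∧ b ∉ Y}
  let Rch : ℤ × ℤ → ℤ × ℤ → Prop := Relation.ReflTransGen (fun a b => GridAdj a b ∧ b ∈ N')
  suffices hgood : ∃ c ∈ N', ∃ c', Rch c c' ∧ (∃ x ∈ X, GridAdj x c) ∧ ∃ y ∈ Y, GridAdj y c' by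
    obtain ⟨c, hc, c', hcc', ⟨x, hx, hxc⟩, y, hy, hyc⟩ := hgood
    let B : Set (ℤ × ℤ) := {b | Rch c b}
    have hB : ∀ b ∈ B, Relation.ReflTransGen (fun a b => GridAdj a b ∧ b ∈ B) c b := by
      intro b hb
      induction hb with
      | refl => exact .refl
      | tail h h' ih => exact .tail ih ⟨h'.1, .tail h h'⟩
    have hcB : c ∈ B := Relation.ReflTransGen.refl
    refine ⟨B, fun b hb => reach_mem hc hb, fun a ha b hb => ?_, ⟨x, hx, c, hcB, hxc⟩,
      y, hy, c', hcc', hyc⟩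
    exact (reach_symm hcB (hB a ha)).trans (hB b hb)
  by_contra hgood
  have main : (p ∈ X → False) ∧
      (p ∈ N' → ∃ c', Rch p c' ∧ ∃ y ∈ Y, GridAdj y c') := by
    clear hpX
    induction hpq using Relation.ReflTransGen.head_induction_on with
    | refl =>
      exact ⟨fun h => Set.disjoint_left.1 hXY h hqY, fun h => absurd hqY h.2.2⟩
    | @head a b hab _ ih =>
      refine ⟨fun ha => ?_, fun ha => ?_⟩
      · by_cases hbY : b ∈ Y
        · exact hadj a ha b hbY hab.1
        have hb : b ∈ N' := ⟨hab.2, fun h => ih.1 h, hbY⟩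
        obtain ⟨c', h1, h2⟩ := ih.2 hb
        exact hgood ⟨b, hb, c', h1, ⟨a, ha, hab.1⟩, h2⟩
      · by_cases hbY : b ∈ Y
        · exact ⟨a, .refl, b, hbY, hab.1.symm⟩
        have hb : b ∈ N' := ⟨hab.2, fun h => ih.1 h, hbY⟩
        obtain ⟨c', h1, h2⟩ := ih.2 hb
        exact ⟨c', .head ⟨hab.1, hb⟩ h1, h2⟩
  exact main.1 hpX

/-- The grid point `p` scaled by `δ`. -/
def gridPoint (δ : ℝ) (p : ℤ × ℤ) : ℝ × ℝ := (δ * p.1, δ * p.2)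

/-- The grid points of mesh `δ` at distance less than `δ` from `S`. -/
def gridNhd (δ : ℝ) (S : Set (ℝ × ℝ)) : Set (ℤ × ℤ) := {p | ∃ s ∈ S, dist (gridPoint δ p) s < δ}

theorem dist_gridPoint_lt {δ : ℝ} {p : ℤ × ℤ} {s : ℝ × ℝ} :
    dist (gridPoint δ p) s < δ ↔ |δ * p.1 - s.1| < δ ∧ |δ * p.2 - s.2| < δ := by
  rw [Prod.dist_eq, max_lt_iff, Real.dist_eq, Real.dist_eq, gridPoint]

theorem exists_gridPoint_near {δ : ℝ} (hδ : 0 < δ) (s : ℝ × ℝ) :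
    ∃ p, dist (gridPoint δ p) s < δ := by
  have key : ∀ x : ℝ, ∃ n : ℤ, |δ * n - x| < δ := by
    intro x
    refine ⟨⌊x / δ⌋, ?_⟩
    have h1 := Int.floor_le (x / δ)
    have h2 := Int.lt_floor_add_one (x / δ)
    rw [le_div_iff₀ hδ] at h1
    rw [div_lt_iff₀ hδ] at h2
    rw [abs_lt]
    constructor <;> nlinarith
  obtain ⟨m, hm⟩ := key s.1
  obtain ⟨n, hn⟩ := key s.2
  exact ⟨(m, n), dist_gridPoint_lt.2 ⟨hm, hn⟩⟩

theorem dist_gridPoint_adj {δ : ℝ} (hδ : 0 < δ) {p q : ℤ × ℤ} (h : GridAdj p q) :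
    dist (gridPoint δ p) (gridPoint δ q) ≤ δ := by
  obtain ⟨d, rfl⟩ := h
  obtain ⟨i, j⟩ := p
  fin_cases d <;>
    simp [gridPoint, gridStep, Prod.dist_eq, mul_add, abs_of_pos hδ, hδ.le]

theorem gridNhd_finite {δ : ℝ} (hδ : 0 < δ) {S : Set (ℝ × ℝ)} (hS : Bornology.IsBounded S) :
    (gridNhd δ S).Finite := by
  obtain ⟨M, hM⟩ := hS.exists_norm_le
  refine (Set.finite_Icc ((-⌈M / δ + 1⌉, -⌈M / δ + 1⌉) : ℤ × ℤ)
    (⌈M / δ + 1⌉, ⌈M / δ + 1⌉)).subset ?_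
  rintro ⟨i, j⟩ ⟨s, hs, hd⟩
  have hn := hM s hs
  rw [Prod.norm_def, max_le_iff, Real.norm_eq_abs, Real.norm_eq_abs] at hn
  rw [dist_gridPoint_lt] at hd
  have key : ∀ (n : ℤ) (x : ℝ), |x| ≤ M → |δ * n - x| < δ →
      -⌈M / δ + 1⌉ ≤ n ∧ n ≤ ⌈M / δ + 1⌉ := by
    intro n x h1 h2
    rw [abs_le] at h1
    rw [abs_lt] at h2
    have h3 := Int.le_ceil (M / δ + 1)
    have h4 : (n : ℝ) ≤ M / δ + 1 := by
      rw [← sub_le_iff_le_add, le_div_iff₀ hδ]; nlinarith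
    have h5 : -(n : ℝ) ≤ M / δ + 1 := by
      rw [← sub_le_iff_le_add, le_div_iff₀ hδ]; nlinarith
    constructor
    · have : (-n : ℤ) ≤ ⌈M / δ + 1⌉ := by exact_mod_cast h5.trans h3
      omega
    · exact_mod_cast h4.trans h3
  obtain ⟨a1, a2⟩ := key i s.1 hn.1 hd.1
  obtain ⟨b1, b2⟩ := key j s.2 hn.2 hd.2
  exact ⟨⟨a1, b1⟩, ⟨a2, b2⟩⟩

/-- Grid neighbourhoods of connected sets are connected. -/
theorem gridNhd_connected {δ : ℝ} (hδ : 0 < δ) {S : Set (ℝ × ℝ)} (hS : IsPreconnected S)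
    {p q : ℤ × ℤ} (hp : p ∈ gridNhd δ S) (hq : q ∈ gridNhd δ S) :
    Relation.ReflTransGen (fun a b => GridAdj a b ∧ b ∈ gridNhd δ S) p q := by
  by_contra hpq
  let C : Set (ℤ × ℤ) :=
    {r | Relation.ReflTransGen (fun a b => GridAdj a b ∧ b ∈ gridNhd δ S) p r}
  let U : Set (ℝ × ℝ) := ⋃ r ∈ C, Metric.ball (gridPoint δ r) δ
  let W : Set (ℝ × ℝ) := ⋃ r ∈ gridNhd δ S \ C, Metric.ball (gridPoint δ r) δ
  have hU : IsOpen U := isOpen_biUnion fun r _ => Metric.isOpen_ball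
  have hW : IsOpen W := isOpen_biUnion fun r _ => Metric.isOpen_ball
  have hcov : S ⊆ U ∪ W := by
    intro s hs
    obtain ⟨r, hr⟩ := exists_gridPoint_near hδ s
    have hs' : s ∈ Metric.ball (gridPoint δ r) δ := by rwa [Metric.mem_ball, _root_.dist_comm]
    by_cases hrC : r ∈ C
    · exact Or.inl (Set.mem_biUnion hrC hs')
    · exact Or.inr (Set.mem_biUnion (⟨⟨s, hs, hr⟩, hrC⟩ : r ∈ gridNhd δ S \ C) hs')
  have hSU : (S ∩ U).Nonempty := by
    obtain ⟨s, hs, h⟩ := hp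
    exact ⟨s, hs, Set.mem_biUnion (Relation.ReflTransGen.refl : p ∈ C)
      (by rwa [Metric.mem_ball, _root_.dist_comm])⟩
  have hSW : (S ∩ W).Nonempty := by
    obtain ⟨s, hs, h⟩ := id hq
    exact ⟨s, hs, Set.mem_biUnion (⟨hq, hpq⟩ : q ∈ gridNhd δ S \ C)
      (by rwa [Metric.mem_ball, _root_.dist_comm])⟩
  obtain ⟨s, hs, hsU, hsW⟩ := hS U W hU hW hcov hSU hSW
  simp only [U, W, Set.mem_iUnion, Metric.mem_ball, exists_prop] at hsU hsW
  obtain ⟨⟨a, b⟩, hr, h1⟩ := hsU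
  obtain ⟨⟨a', b'⟩, ⟨hrN', hr'⟩, h2⟩ := hsW
  rw [_root_.dist_comm, dist_gridPoint_lt] at h1 h2
  have key : ∀ (m n : ℤ) (x : ℝ), |δ * m - x| < δ → |δ * n - x| < δ →
      n = m ∨ n = m + 1 ∨ n = m + -1 := by
    intro m n x h1 h2
    rw [abs_lt] at h1 h2
    have e1 : (n : ℝ) - m < 2 := by nlinarith
    have e2 : (m : ℝ) - n < 2 := by nlinarith
    have e1' : n - m < 2 := by exact_mod_cast e1
    have e2' : m - n < 2 := by exact_mod_cast e2
    omega
  have step : ∀ x y : ℤ × ℤ, x ∈ C → dist (gridPoint δ y) s < δ →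
      (x = y ∨ GridAdj x y) → y ∈ C := by
    rintro x y hx hy (rfl | h)
    · exact hx
    · exact Relation.ReflTransGen.tail hx ⟨h, s, hs, hy⟩
  have hc : (a', b) ∈ C := by
    refine step _ _ hr (dist_gridPoint_lt.2 ⟨h2.1, h1.2⟩) ?_
    rcases key a a' s.1 h1.1 h2.1 with rfl | rfl | rfl
    · exact Or.inl rfl
    · exact Or.inr ⟨0, by simp [gridStep]⟩
    · exact Or.inr ⟨1, by simp [gridStep]⟩
  refine hr' (step _ _ hc (dist_gridPoint_lt.2 h2) ?_)
  rcases key b b' s.2 h1.2 h2.2 with rfl | rfl | rfl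
  · exact Or.inl rfl
  · exact Or.inr ⟨2, by simp [gridStep]⟩
  · exact Or.inr ⟨3, by simp [gridStep]⟩

/-- A family of pairwise disjoint sets comes from a labelling. -/
theorem exists_labelling {α L : Type*} (F : L → Set α) (hF : ∀ x y, x ≠ y → Disjoint (F x) (F y)) :
    ∃ β : α → Option L, ∀ p x, β p = some x ↔ p ∈ F x := by
  classical
  refine ⟨fun p => if h : ∃ x, p ∈ F x then some h.choose else none, fun p x => ?_⟩
  by_cases h : ∃ x, p ∈ F x
  · beta_reduce
    rw [dif_pos h, Option.some_inj]
    refine ⟨fun hx => hx ▸ h.choose_spec, fun hx => ?_⟩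
    by_contra hne
    exact Set.disjoint_left.1 (hF _ _ hne) h.choose_spec hx
  · beta_reduce
    rw [dif_neg h]
    simpa using fun hx => h ⟨x, hx⟩

end Discretization

section Drawing

open Topology Filter

/-- The arcs of a planar embedding, as compact connected sets indexed by the edges. -/
theorem exists_arcs_of_hasPlanarEmbedding {V : Type*} {G : SimpleGraph V}
    (h : G.HasPlanarEmbedding) :
    ∃ (pos : V → ℝ × ℝ) (A : G.edgeSet → Set (ℝ × ℝ)), Function.Injective pos ∧
      (∀ e, IsCompact (A e) ∧ IsPreconnected (A e)) ∧ (∀ e v, pos v ∈ A e ↔ v ∈ e.1) ∧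
      ∀ e e' x, e ≠ e' → x ∈ A e → x ∈ A e' → ∃ v, x = pos v := by
  obtain ⟨pos, arc, hpos, harc, hdisj⟩ := h
  have hrep : ∀ e : G.edgeSet, ∃ u v, e.1 = s(u, v) ∧ G.Adj u v := by
    rintro ⟨e, he⟩
    induction e using Sym2.ind with
    | _ u v => exact ⟨u, v, rfl, he⟩
  choose a b hab hadj using hrep
  have hsplit : ∀ t ∈ Set.Icc (0 : ℝ) 1, t = 0 ∨ t = 1 ∨ t ∈ Set.Ioo (0 : ℝ) 1 := by
    intro t ht
    rcases ht.1.eq_or_lt with h | h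
    · exact Or.inl h.symm
    · rcases ht.2.eq_or_lt with h' | h'
      · exact Or.inr (Or.inl h')
      · exact Or.inr (Or.inr ⟨h, h'⟩)
  refine ⟨pos, fun e => arc (a e) (b e) '' Set.Icc 0 1, hpos, fun e => ?_, fun e v => ?_, ?_⟩
  · have hc := (harc _ _ (hadj e)).1
    exact ⟨isCompact_Icc.image_of_continuousOn hc, isPreconnected_Icc.image _ hc⟩
  · obtain ⟨-, -, h0, h1, -, h2⟩ := harc _ _ (hadj e)
    rw [hab e, Sym2.mem_iff]
    constructor
    · rintro ⟨t, ht, hv⟩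
      rcases hsplit t ht with rfl | rfl | ht
      · exact Or.inl (hpos (hv.symm.trans h0))
      · exact Or.inr (hpos (hv.symm.trans h1))
      · exact absurd hv (h2 v t ht)
    · rintro (rfl | rfl)
      · exact ⟨0, by simp, h0⟩
      · exact ⟨1, by simp, h1⟩
  · rintro e e' x hne ⟨t, ht, rfl⟩ ⟨t', ht', hx⟩
    obtain ⟨-, -, h0, h1, -⟩ := harc _ _ (hadj e)
    obtain ⟨-, -, h0', h1', -⟩ := harc _ _ (hadj e')
    rcases hsplit t ht with rfl | rfl | ht
    · exact ⟨_, h0⟩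
    · exact ⟨_, h1⟩
    rcases hsplit t' ht' with rfl | rfl | ht'
    · exact ⟨_, hx.symm.trans h0'⟩
    · exact ⟨_, hx.symm.trans h1'⟩
    refine absurd hx.symm (hdisj _ _ _ _ (hadj e) (hadj e') ?_ t ht t' ht')
    rw [← hab e, ← hab e']
    exact fun h => hne (Subtype.ext h)

theorem exists_pos_forall_of_finite {ι : Type*} [Finite ι] {P : ι → ℝ → Prop}
    (h : ∀ i, ∃ r > 0, ∀ s, 0 < s → s ≤ r → P i s) :
    ∃ r > 0, ∀ i, P i r := by
  have : ∀ᶠ s in 𝓝[>] (0 : ℝ), ∀ i, P i s := by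
    rw [eventually_all]
    intro i
    obtain ⟨r, hr, hP⟩ := h i
    filter_upwards [Ioc_mem_nhdsGT hr] with s hs using hP s hs.1 hs.2
  obtain ⟨r, hP, hr⟩ := (this.and self_mem_nhdsWithin).exists
  exact ⟨r, hr, hP⟩

/-- A planar embedding of a finite graph can be discretized on a fine grid. -/
theorem exists_grid_labelling_of_hasPlanarEmbedding {V : Type*} [Finite V]
    {G : SimpleGraph V} (h : G.HasPlanarEmbedding) :
    ∃ β : ℤ × ℤ → Option (V ⊕ G.edgeSet),
      (∀ x, {p | β p = some x}.Finite) ∧ (∀ x, ∃ p, β p = some x) ∧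
      (∀ x p q, β p = some x → β q = some x →
        Relation.ReflTransGen (fun a b => GridAdj a b ∧ β b = some x) p q) ∧
      ∀ (e : G.edgeSet) (v : V), v ∈ e.1 →
        ∃ p d, β p = some (Sum.inl v) ∧ β (p + gridStep d) = some (Sum.inr e) := by
  obtain ⟨pos, A, hpos, hA, hmem, hAA⟩ := exists_arcs_of_hasPlanarEmbedding h
  obtain ⟨ρ, hρ, hρ'⟩ : ∃ ρ > 0, ∀ i : (V × V) ⊕ (G.edgeSet × V),
      Sum.elim (fun w => w.1 ≠ w.2 → 4 * ρ ≤ dist (pos w.1) (pos w.2))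
        (fun w => w.2 ∉ w.1.1 → ∀ x ∈ A w.1, 2 * ρ ≤ dist x (pos w.2)) i := by
    refine exists_pos_forall_of_finite (P := fun (i : (V × V) ⊕ (G.edgeSet × V)) ρ => Sum.elim
      (fun w => w.1 ≠ w.2 → 4 * ρ ≤ dist (pos w.1) (pos w.2))
      (fun w => w.2 ∉ w.1.1 → ∀ x ∈ A w.1, 2 * ρ ≤ dist x (pos w.2)) i) ?_
    rintro (⟨u, v⟩ | ⟨e, v⟩)
    · by_cases huv : u = v
      · exact ⟨1, one_pos, fun s _ _ h => absurd huv h⟩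
      · refine ⟨dist (pos u) (pos v) / 4, by
          have := dist_pos.2 (hpos.ne huv); positivity, fun s _ hs _ => ?_⟩
        change 4 * s ≤ dist (pos u) (pos v)
        linarith
    · by_cases hv : v ∈ e.1
      · exact ⟨1, one_pos, fun s _ _ h => absurd hv h⟩
      · have h1 : pos v ∈ (A e)ᶜ := fun h => hv ((hmem e v).1 h)
        obtain ⟨ε, hε, hb⟩ := Metric.isOpen_iff.1 (hA e).1.isClosed.isOpen_compl _ h1
        refine ⟨ε / 2, half_pos hε, fun s _ hs _ x hx => ?_⟩
        by_contra! hlt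
        exact hb (Metric.mem_ball.2 (by linarith : dist x (pos v) < ε)) hx
  have hρV : ∀ u v, u ≠ v → 4 * ρ ≤ dist (pos u) (pos v) := fun u v => hρ' (Sum.inl (u, v))
  have hρE : ∀ (e : G.edgeSet) v, v ∉ e.1 → ∀ x ∈ A e, 2 * ρ ≤ dist x (pos v) :=
    fun e v => hρ' (Sum.inr (e, v))
  let K : G.edgeSet → Set (ℝ × ℝ) := fun e => {x | x ∈ A e ∧ ∀ v, ρ ≤ dist x (pos v)}
  have hK : ∀ e, IsCompact (K e) := by
    intro e
    refine (hA e).1.inter_right (t := {x : ℝ × ℝ | ∀ v, ρ ≤ dist x (pos v)}) ?_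
    simp only [Set.ofPred_forall]
    exact isClosed_iInter fun v => isClosed_le continuous_const (by fun_prop)
  have hKd : ∀ e e', e ≠ e' → Disjoint (K e) (K e') := by
    intro e e' hne
    rw [Set.disjoint_left]
    rintro x ⟨hx, hv⟩ ⟨hx', -⟩
    obtain ⟨v, rfl⟩ := hAA e e' x hne hx hx'
    have := hv v
    rw [_root_.dist_self] at this
    linarith
  obtain ⟨η, hη, hη'⟩ : ∃ η > 0, ∀ w : G.edgeSet × G.edgeSet, w.1 ≠ w.2 →
      ∀ x ∈ K w.1, ∀ y ∈ K w.2, η ≤ dist x y := by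
    refine exists_pos_forall_of_finite (P := fun (w : G.edgeSet × G.edgeSet) η => w.1 ≠ w.2 →
      ∀ x ∈ K w.1, ∀ y ∈ K w.2, η ≤ dist x y) ?_
    rintro ⟨e, e'⟩
    by_cases hne : e = e'
    · exact ⟨1, one_pos, fun s _ _ h => absurd hne h⟩
    · obtain ⟨ε, hε, hd⟩ := (hKd e e' hne).exists_thickenings (hK e) (hK e').isClosed
      refine ⟨ε, hε, fun s _ hs _ x hx y hy => ?_⟩
      by_contra! hlt
      refine Set.disjoint_left.1 hd (Metric.self_subset_thickening hε _ hx) ?_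
      exact Metric.mem_thickening_iff.2 ⟨y, hy, by linarith⟩
  obtain ⟨δ, hδ, hδρ, hδη⟩ : ∃ δ > 0, 2 * δ ≤ ρ ∧ 2 * δ ≤ η :=
    ⟨min ρ η / 2, half_pos (lt_min hρ hη), by linarith [min_le_left ρ η],
      by linarith [min_le_right ρ η]⟩
  let F : V → Set (ℤ × ℤ) := fun v => gridNhd δ (Metric.closedBall (pos v) ρ)
  have hF : ∀ v p, p ∈ F v → dist (gridPoint δ p) (pos v) < ρ + δ := by
    rintro v p ⟨s, hs, hd⟩
    rw [Metric.mem_closedBall] at hs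
    linarith [dist_triangle (gridPoint δ p) s (pos v)]
  have hFd : ∀ u v, u ≠ v → Disjoint (F u) (F v) := by
    intro u v huv
    rw [Set.disjoint_left]
    intro p hp hq
    linarith [dist_triangle_left (pos u) (pos v) (gridPoint δ p), hF u p hp, hF v p hq,
      hρV u v huv]
  have hFa : ∀ u v, u ≠ v → ∀ p ∈ F u, ∀ q ∈ F v, ¬ GridAdj p q := by
    intro u v huv p hp q hq hpq
    linarith [dist_triangle_left (pos u) (pos v) (gridPoint δ p), hF u p hp, hF v q hq,
      hρV u v huv, dist_gridPoint_adj hδ hpq, dist_triangle (gridPoint δ p) (gridPoint δ q) (pos v)]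
  have hBex : ∀ e : G.edgeSet, ∃ B : Set (ℤ × ℤ), (∀ b ∈ B, b ∈ gridNhd δ (A e)) ∧
      (∀ v ∈ e.1, ∀ b ∈ B, b ∉ F v) ∧
      (∀ a ∈ B, ∀ b ∈ B, Relation.ReflTransGen (fun a b => GridAdj a b ∧ b ∈ B) a b) ∧
      (∃ b, b ∈ B) ∧ ∀ v ∈ e.1, ∃ x ∈ F v, ∃ b ∈ B, GridAdj x b := by
    intro e
    obtain ⟨u, v, he, huv⟩ : ∃ u v, e.1 = s(u, v) ∧ u ≠ v := by
      obtain ⟨e, he⟩ := e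
      induction e using Sym2.ind with
      | _ u v => exact ⟨u, v, rfl, G.ne_of_adj he⟩
    obtain ⟨p, hp⟩ := exists_gridPoint_near hδ (pos u)
    obtain ⟨q, hq⟩ := exists_gridPoint_near hδ (pos v)
    have hu : pos u ∈ A e := (hmem e u).2 (by simp [he])
    have hv : pos v ∈ A e := (hmem e v).2 (by simp [he])
    obtain ⟨B, h1, h2, h3, h4⟩ := exists_connector (hFd u v huv) (hFa u v huv)
      (p := p) (q := q) ⟨pos u, Metric.mem_closedBall_self hρ.le, hp⟩
      ⟨pos v, Metric.mem_closedBall_self hρ.le, hq⟩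
      (gridNhd_connected hδ (hA e).2 ⟨_, hu, hp⟩ ⟨_, hv, hq⟩)
    refine ⟨B, fun b hb => (h1 b hb).1, ?_, h2, ?_, ?_⟩
    · intro w hw b hb
      rw [he, Sym2.mem_iff] at hw
      rcases hw with rfl | rfl
      · exact (h1 b hb).2.1
      · exact (h1 b hb).2.2
    · obtain ⟨-, -, b, hb, -⟩ := h3
      exact ⟨b, hb⟩
    · intro w hw
      rw [he, Sym2.mem_iff] at hw
      rcases hw with rfl | rfl
      · exact h3
      · exact h4
  choose B hB hBF hBc hBn hBa using hBex
  have hBF' : ∀ e v, Disjoint (B e) (F v) := by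
    intro e v
    rw [Set.disjoint_left]
    intro b hb hbv
    by_cases hv : v ∈ e.1
    · exact hBF e v hv b hb hbv
    · obtain ⟨s, hs, hd⟩ := hB e b hb
      linarith [hρE e v hv s hs, hF v b hbv, dist_triangle_left s (pos v) (gridPoint δ b)]
  have hBK : ∀ e, ∀ b ∈ B e, ∃ s ∈ K e, dist (gridPoint δ b) s < δ := by
    intro e b hb
    obtain ⟨s, hs, hd⟩ := hB e b hb
    refine ⟨s, ⟨hs, fun v => ?_⟩, hd⟩
    by_contra! hlt
    exact Set.disjoint_left.1 (hBF' e v) hb ⟨s, hlt.le, hd⟩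
  have hBB : ∀ e e', e ≠ e' → Disjoint (B e) (B e') := by
    intro e e' hne
    rw [Set.disjoint_left]
    intro b hb hb'
    obtain ⟨s, hs, hd⟩ := hBK e b hb
    obtain ⟨s', hs', hd'⟩ := hBK e' b hb'
    linarith [hη' (e, e') hne s hs s' hs', dist_triangle_left s s' (gridPoint δ b)]
  obtain ⟨β, hβ⟩ := exists_labelling (Sum.elim F B) (by
    rintro (u | e) (v | e') hne
    · exact hFd u v fun h => hne (by rw [h])
    · exact (hBF' e' u).symm
    · exact hBF' e v
    · exact hBB e e' fun h => hne (by rw [h]))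
  refine ⟨β, ?_, ?_, ?_, ?_⟩
  · rintro (v | e)
    · simp only [hβ]
      exact gridNhd_finite hδ Metric.isBounded_closedBall
    · simp only [hβ]
      exact (gridNhd_finite hδ (hA e).1.isBounded).subset (hB e)
  · rintro (v | e)
    · obtain ⟨p, hp⟩ := exists_gridPoint_near hδ (pos v)
      exact ⟨p, (hβ _ _).2 ⟨pos v, Metric.mem_closedBall_self hρ.le, hp⟩⟩
    · obtain ⟨b, hb⟩ := hBn e
      exact ⟨b, (hβ _ _).2 hb⟩
  · rintro (v | e) p q hp hq
    · simp only [hβ] at hp hq ⊢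
      exact gridNhd_connected hδ (convex_closedBall (pos v) ρ).isPreconnected hp hq
    · simp only [hβ] at hp hq ⊢
      exact hBc e p hp q hq
  · intro e v hv
    obtain ⟨p, hp, b, hb, d, rfl⟩ := hBa e v hv
    exact ⟨p, d, (hβ _ _).2 hp, (hβ _ _).2 hb⟩

end Drawing

section UpperBound

theorem IsAbstractDual.exists_finite {V : Type*} [Fintype V] [DecidableEq V] {G : SimpleGraph V}
    [Fintype G.edgeSet] {Q : Type} {l r : G.edgeSet → Q} (h : IsAbstractDual G l r) :
    ∃ (Q' : Type) (_ : Finite Q') (l' r' : G.edgeSet → Q'), IsAbstractDual G l' r' := by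
  classical
  let R : Set Q := Set.range l ∪ Set.range r
  refine ⟨R, ((Set.finite_range l).union (Set.finite_range r)).to_subtype,
    fun e => ⟨l e, Or.inl ⟨e, rfl⟩⟩, fun e => ⟨r e, Or.inr ⟨e, rfl⟩⟩, fun z hz => ?_,
    fun g v => ?_⟩
  · obtain ⟨g, hg⟩ := h.1 z hz
    exact ⟨fun q => g q.1, hg⟩
  · rw [← h.2 (fun q => if hq : q ∈ R then g ⟨q, hq⟩ else 0) v]
    refine Finset.sum_congr rfl fun e _ => ?_
    have hl : l e ∈ R := Or.inl ⟨e, rfl⟩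
    have hr : r e ∈ R := Or.inr ⟨e, rfl⟩
    beta_reduce
    rw [dif_pos hl, dif_pos hr]

/-- A planar graph on `n ≥ 4` vertices without a copy of `theta4` has at most `12 (n - 2) / 5`
edges. -/
theorem five_mul_ncard_edgeSet_le {V : Type*} [Fintype V] {G : SimpleGraph V}
    (hG : G.HasPlanarEmbedding) (h4 : ¬ ContainsCopy theta4 G) (hV : 4 ≤ Fintype.card V) :
    5 * G.edgeSet.ncard ≤ 12 * (Fintype.card V - 2) := by
  classical
  obtain ⟨β, h1, h2, h3, h5⟩ := exists_grid_labelling_of_hasPlanarEmbedding hG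
  obtain ⟨Q, l, r, h⟩ := exists_isAbstractDual_of_grid β h1 h2 h3 h5
  obtain ⟨Q', _, l', r', h'⟩ := h.exists_finite
  rw [← Nat.card_coe_set_eq, Nat.card_eq_fintype_card]
  exact h'.edge_bound h4 hV

end UpperBound

section Construction

/-- Rotation of the plane by `j` quarter turns. -/
def quarterTurn {R : Type*} [Neg R] (j : Fin 4) (p : R × R) : R × R :=
  ![p, (-p.2, p.1), (-p.1, -p.2), (p.2, -p.1)] j

/-- Up to rotation and scaling, the segments drawn in one layer: twelve edges, followed by the five
vertices as degenerate segments. -/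
def layerSeg : Fin 17 → (ℤ × ℤ) × (ℤ × ℤ) :=
  ![((10, 10), (-10, 10)), ((10, 10), (0, 8)), ((-10, 10), (0, 8)), ((0, 8), (6, 6)),
    ((0, 8), (-6, 6)), ((6, 6), (-6, 6)), ((4, 2), (2, 4)), ((2, 4), (-2, 4)), ((4, 2), (6, 6)),
    ((2, 4), (6, 6)), ((2, 2), (4, 2)), ((-2, 2), (2, 4)), ((4, 2), (4, 2)), ((2, 4), (2, 4)),
    ((10, 10), (10, 10)), ((0, 8), (0, 8)), ((6, 6), (6, 6))]

/-- The endpoints of a rotated segment of a layer. -/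
def layerPt (o : Fin 17) (j : Fin 4) (b : Bool) : ℤ × ℤ :=
  quarterTurn j (if b then (layerSeg o).2 else (layerSeg o).1)

/-- The linear form with coefficients `n`. -/
def planeForm {R : Type*} [Add R] [Mul R] (n p : R × R) : R := n.1 * p.1 + n.2 * p.2

theorem layer_separated (o o' : Fin 17) (j j' : Fin 4) (h : (o, j) ≠ (o', j')) :
    ∃ m : Fin 2, ∃ i : Fin 4,
      (∀ b b', planeForm (quarterTurn i (1, (m : ℤ))) (layerPt o j b) ≤
        planeForm (quarterTurn i (1, (m : ℤ))) (layerPt o' j' b')) ∧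
      ∃ b b', planeForm (quarterTurn i (1, (m : ℤ))) (layerPt o j b) <
        planeForm (quarterTurn i (1, (m : ℤ))) (layerPt o' j' b') := by
  revert o o' j j'
  decide +kernel

theorem layer_norm (o : Fin 17) (j : Fin 4) :
    (∀ b, |(layerPt o j b).1| ≤ 10 ∧ |(layerPt o j b).2| ≤ 10) ∧
      ∃ i : Fin 4, (∀ b, 2 ≤ planeForm (quarterTurn i (1, 0)) (layerPt o j b)) ∧
        ∃ b, 2 < planeForm (quarterTurn i (1, 0)) (layerPt o j b) := by
  revert o j
  decide +kernel

/-- The point of parameter `t` on a segment of layer `l`. -/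
noncomputable def drawPt (l : ℕ) (o : Fin 17) (j : Fin 4) (t : ℝ) : ℝ × ℝ :=
  (5 : ℝ) ^ l • ((1 - t) • (((layerPt o j false).1 : ℝ), ((layerPt o j false).2 : ℝ)) +
    t • (((layerPt o j true).1 : ℝ), ((layerPt o j true).2 : ℝ)))


theorem planeForm_drawPt (n : ℤ × ℤ) (l : ℕ) (o : Fin 17) (j : Fin 4) (t : ℝ) :
    planeForm ((n.1 : ℝ), (n.2 : ℝ)) (drawPt l o j t) =
      5 ^ l * ((1 - t) * (planeForm n (layerPt o j false) : ℤ) +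
        t * (planeForm n (layerPt o j true) : ℤ)) := by
  simp only [planeForm, drawPt, Prod.smul_mk, Prod.mk_add_mk, smul_eq_mul, Int.cast_add,
    Int.cast_mul]
  ring

theorem abs_combination_le {t : ℝ} (ht : t ∈ Set.Ioo (0 : ℝ) 1) {a b : ℤ} {M : ℕ}
    (ha : |a| ≤ M) (hb : |b| ≤ M) : |(1 - t) * (a : ℝ) + t * b| ≤ M := by
  obtain ⟨h0, h1⟩ := ht
  have ha' : |(a : ℝ)| ≤ M := by exact_mod_cast ha
  have hb' : |(b : ℝ)| ≤ M := by exact_mod_cast hb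
  rw [abs_le] at ha' hb' ⊢
  constructor <;> nlinarith

theorem drawPt_abs_le (l : ℕ) (o : Fin 17) (j : Fin 4) {t : ℝ} (ht : t ∈ Set.Ioo (0 : ℝ) 1)
    (i : Fin 4) :
    planeForm (((quarterTurn i ((1 : ℤ), (0 : ℤ))).1 : ℝ),
      ((quarterTurn i ((1 : ℤ), (0 : ℤ))).2 : ℝ))
      (drawPt l o j t) ≤ 10 * 5 ^ l := by
  have h := (layer_norm o j).1
  have h1 := abs_combination_le ht (M := 10) (h false).1 (h true).1
  have h2 := abs_combination_le ht (M := 10) (h false).2 (h true).2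
  rw [abs_le] at h1 h2
  have h5 : (0 : ℝ) < 5 ^ l := by positivity
  rw [planeForm_drawPt, mul_comm]
  refine mul_le_mul_of_nonneg_right ?_ h5.le
  push_cast at h1 h2
  fin_cases i <;> simp [planeForm, quarterTurn] <;> linarith

theorem exists_lt_drawPt (l : ℕ) (o : Fin 17) (j : Fin 4) {t : ℝ} (ht : t ∈ Set.Ioo (0 : ℝ) 1) :
    ∃ i : Fin 4, 2 * 5 ^ l < planeForm (((quarterTurn i ((1 : ℤ), (0 : ℤ))).1 : ℝ),
      ((quarterTurn i ((1 : ℤ), (0 : ℤ))).2 : ℝ)) (drawPt l o j t) := by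
  obtain ⟨i, h, b, hb⟩ := (layer_norm o j).2
  refine ⟨i, ?_⟩
  obtain ⟨h0, h1⟩ := ht
  have h5 : (0 : ℝ) < 5 ^ l := by positivity
  rw [planeForm_drawPt, mul_comm]
  refine mul_lt_mul_of_pos_left ?_ h5
  have hf : (2 : ℝ) ≤ (planeForm (quarterTurn i ((1 : ℤ), (0 : ℤ))) (layerPt o j false) : ℤ) := by
    exact_mod_cast h false
  have ht : (2 : ℝ) ≤ (planeForm (quarterTurn i ((1 : ℤ), (0 : ℤ))) (layerPt o j true) : ℤ) := by
    exact_mod_cast h true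
  have hb' : (2 : ℝ) < (planeForm (quarterTurn i ((1 : ℤ), (0 : ℤ))) (layerPt o j b) : ℤ) := by
    exact_mod_cast hb
  cases b <;> nlinarith

/-- Interiors of distinct segments of the drawing are disjoint. -/
theorem drawPt_inj {l l' : ℕ} {o o' : Fin 17} {j j' : Fin 4} {t t' : ℝ}
    (ht : t ∈ Set.Ioo (0 : ℝ) 1) (ht' : t' ∈ Set.Ioo (0 : ℝ) 1)
    (h : drawPt l o j t = drawPt l' o' j' t') : l = l' ∧ o = o' ∧ j = j' := by
  have hlevel : ∀ {l l' : ℕ} {o o' : Fin 17} {j j' : Fin 4} {t t' : ℝ}, t ∈ Set.Ioo (0 : ℝ) 1 →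
      t' ∈ Set.Ioo (0 : ℝ) 1 → drawPt l o j t = drawPt l' o' j' t' → l' ≤ l := by
    intro l l' o o' j j' t t' ht ht' h
    by_contra! hlt
    obtain ⟨i, hi⟩ := exists_lt_drawPt l' o' j' ht'
    rw [← h] at hi
    have h1 := drawPt_abs_le l o j ht i
    have h2 : (5 : ℝ) ^ (l + 1) ≤ 5 ^ l' := pow_le_pow_right₀ (by norm_num) hlt
    rw [pow_succ] at h2
    linarith
  obtain rfl : l = l' := le_antisymm (hlevel ht' ht h.symm) (hlevel ht ht' h)
  refine ⟨rfl, ?_⟩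
  by_contra hne
  obtain ⟨m, i, hle, b, b', hlt⟩ := layer_separated o o' j j' fun h => hne (by simpa using h)
  have h5 : (0 : ℝ) < 5 ^ l := by positivity
  have hform := congrArg (planeForm (((quarterTurn i ((1 : ℤ), ((m : ℕ) : ℤ))).1 : ℝ),
    ((quarterTurn i ((1 : ℤ), ((m : ℕ) : ℤ))).2 : ℝ))) h
  rw [planeForm_drawPt, planeForm_drawPt, mul_right_inj' h5.ne'] at hform
  generalize quarterTurn i ((1 : ℤ), ((m : ℕ) : ℤ)) = n at *
  have hle' : ∀ b b', ((planeForm n (layerPt o j b) : ℤ) : ℝ) ≤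
      (planeForm n (layerPt o' j' b') : ℤ) := fun b b' => by exact_mod_cast hle b b'
  have hlt' : ((planeForm n (layerPt o j b) : ℤ) : ℝ) < (planeForm n (layerPt o' j' b') : ℤ) := by
    exact_mod_cast hlt
  have a1 := hle' false false
  have a2 := hle' false true
  have a3 := hle' true false
  have a4 := hle' true true
  obtain ⟨h0, h1⟩ := ht
  obtain ⟨h0', h1'⟩ := ht'
  have c1 : 0 < (1 - t) * (1 - t') := mul_pos (by linarith) (by linarith)
  have c2 : 0 < (1 - t) * t' := mul_pos (by linarith) h0'
  have c3 : 0 < t * (1 - t') := mul_pos h0 (by linarith)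
  have c4 : 0 < t * t' := mul_pos h0 h0'
  have d1 := mul_le_mul_of_nonneg_left a1 c1.le
  have d2 := mul_le_mul_of_nonneg_left a2 c2.le
  have d3 := mul_le_mul_of_nonneg_left a3 c3.le
  have d4 := mul_le_mul_of_nonneg_left a4 c4.le
  cases b <;> cases b'
  · have := mul_lt_mul_of_pos_left hlt' c1
    linarith
  · have := mul_lt_mul_of_pos_left hlt' c2
    linarith
  · have := mul_lt_mul_of_pos_left hlt' c3
    linarith
  · have := mul_lt_mul_of_pos_left hlt' c4
    linarith


/-- The ends of the twelve edges of a layer, each given by its kind, its level relative to the layer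
and its rotation. -/
def layerEnds : Fin 12 → (Fin 5 × ℕ × Fin 4) × (Fin 5 × ℕ × Fin 4) :=
  ![((2, 1, 0), (2, 1, 1)), ((2, 1, 0), (3, 1, 0)), ((2, 1, 1), (3, 1, 0)), ((3, 1, 0), (4, 1, 0)),
    ((3, 1, 0), (4, 1, 1)), ((4, 1, 0), (4, 1, 1)), ((0, 1, 0), (1, 1, 0)), ((1, 1, 0), (0, 1, 1)),
    ((0, 1, 0), (4, 1, 0)), ((1, 1, 0), (4, 1, 0)), ((2, 0, 0), (0, 1, 0)), ((2, 0, 1), (1, 1, 0))]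

/-- Move a vertex up `i` levels and rotate it by `j` quarter turns. -/
def nodeShift (i : ℕ) (j : Fin 4) (x : Fin 5 × ℕ × Fin 4) : Fin 5 × ℕ × Fin 4 :=
  (x.1, i + x.2.1, j + x.2.2)

/-- The edge of kind `c` in layer `i`, rotated by `j` quarter turns. -/
def layerEdge (x : Fin 12 × ℕ × Fin 4) : Sym2 (Fin 5 × ℕ × Fin 4) :=
  s(nodeShift x.2.1 x.2.2 (layerEnds x.1).1, nodeShift x.2.1 x.2.2 (layerEnds x.1).2)

/-- The infinite layered graph. -/
def layerGraph : SimpleGraph (Fin 5 × ℕ × Fin 4) := fromEdgeSet (Set.range layerEdge)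

/-- The position of a vertex of the layered graph. -/
noncomputable def nodePos (x : Fin 5 × ℕ × Fin 4) : ℝ × ℝ :=
  drawPt x.2.1 (Fin.natAdd 12 x.1) x.2.2 (1 / 2)

theorem half_mem_Ioo : (1 / 2 : ℝ) ∈ Set.Ioo (0 : ℝ) 1 := by
  norm_num

theorem nodePos_injective : Function.Injective nodePos := by
  rintro ⟨t, l, j⟩ ⟨t', l', j'⟩ h
  obtain ⟨rfl, h, rfl⟩ := drawPt_inj half_mem_Ioo half_mem_Ioo h
  rw [Fin.natAdd_inj] at h
  obtain rfl : t = t' := h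
  rfl

theorem layerEnds_position (c : Fin 12) (j : Fin 4) :
    (5 * (layerPt (Fin.castLE (by decide) c) j false).1 = 5 ^ (layerEnds c).1.2.1 *
      (layerPt (Fin.natAdd 12 (layerEnds c).1.1) (j + (layerEnds c).1.2.2) false).1 ∧
    5 * (layerPt (Fin.castLE (by decide) c) j false).2 = 5 ^ (layerEnds c).1.2.1 *
      (layerPt (Fin.natAdd 12 (layerEnds c).1.1) (j + (layerEnds c).1.2.2) false).2) ∧
    (5 * (layerPt (Fin.castLE (by decide) c) j true).1 = 5 ^ (layerEnds c).2.2.1 *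
      (layerPt (Fin.natAdd 12 (layerEnds c).2.1) (j + (layerEnds c).2.2.2) false).1 ∧
    5 * (layerPt (Fin.castLE (by decide) c) j true).2 = 5 ^ (layerEnds c).2.2.1 *
      (layerPt (Fin.natAdd 12 (layerEnds c).2.1) (j + (layerEnds c).2.2.2) false).2) := by
  revert c j
  decide +kernel

theorem layerPt_vertex (t : Fin 5) (j : Fin 4) :
    layerPt (Fin.natAdd 12 t) j true = layerPt (Fin.natAdd 12 t) j false := by
  revert t j
  decide +kernel

theorem nodePos_shift (i : ℕ) (j : Fin 4) (x : Fin 5 × ℕ × Fin 4) {a b : ℤ}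
    (ha : 5 * a = 5 ^ x.2.1 * (layerPt (Fin.natAdd 12 x.1) (j + x.2.2) false).1)
    (hb : 5 * b = 5 ^ x.2.1 * (layerPt (Fin.natAdd 12 x.1) (j + x.2.2) false).2) :
    nodePos (nodeShift i j x) = (5 ^ (i + 1) * (a : ℝ), 5 ^ (i + 1) * (b : ℝ)) := by
  have ha' : 5 * (a : ℝ) = 5 ^ x.2.1 *
    ((layerPt (Fin.natAdd 12 x.1) (j + x.2.2) false).1 : ℤ) := by exact_mod_cast ha
  have hb' : 5 * (b : ℝ) = 5 ^ x.2.1 *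
    ((layerPt (Fin.natAdd 12 x.1) (j + x.2.2) false).2 : ℤ) := by exact_mod_cast hb
  simp only [nodePos, nodeShift, drawPt, layerPt_vertex, Prod.smul_mk, Prod.mk_add_mk, smul_eq_mul]
  ext
  · change (5 : ℝ) ^ (i + x.2.1) * _ = 5 ^ (i + 1) * (a : ℝ)
    rw [pow_succ, mul_assoc, ha']
    ring
  · change (5 : ℝ) ^ (i + x.2.1) * _ = 5 ^ (i + 1) * (b : ℝ)
    rw [pow_succ, mul_assoc, hb']
    ring

theorem segment_eq_drawPt (c : Fin 12) (i : ℕ) (j : Fin 4) (t : ℝ) :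
    (1 - t) • nodePos (nodeShift i j (layerEnds c).1) +
        t • nodePos (nodeShift i j (layerEnds c).2) =
      drawPt (i + 1) (Fin.castLE (by decide) c) j t := by
  obtain ⟨⟨h1, h2⟩, h3, h4⟩ := layerEnds_position c j
  rw [nodePos_shift i j _ h1 h2, nodePos_shift i j _ h3 h4, drawPt]
  simp only [Prod.smul_mk, Prod.mk_add_mk, smul_eq_mul]
  ext <;> ring

/-- An open segment between the ends of an edge is a segment of the drawing. -/
theorem exists_drawPt_of_edge {x y : Fin 5 × ℕ × Fin 4} {c : Fin 12} {i : ℕ} {j : Fin 4}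
    (h : s(x, y) = layerEdge (c, i, j)) {t : ℝ} (ht : t ∈ Set.Ioo (0 : ℝ) 1) :
    ∃ t' ∈ Set.Ioo (0 : ℝ) 1, (1 - t) • nodePos x + t • nodePos y =
      drawPt (i + 1) (Fin.castLE (by decide) c) j t' := by
  rw [layerEdge, Sym2.eq_iff] at h
  rcases h with ⟨rfl, rfl⟩ | ⟨rfl, rfl⟩
  · exact ⟨t, ht, segment_eq_drawPt c i j t⟩
  · refine ⟨1 - t, ⟨by linarith [ht.2], by linarith [ht.1]⟩, ?_⟩
    rw [← segment_eq_drawPt, sub_sub_cancel, add_comm]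

theorem layerEdge_injective : Function.Injective layerEdge := by
  rintro ⟨c, i, j⟩ ⟨c', i', j'⟩ h
  obtain ⟨t, ht, h1⟩ := exists_drawPt_of_edge (c := c) (i := i) (j := j) rfl half_mem_Ioo
  obtain ⟨t', ht', h2⟩ := exists_drawPt_of_edge (c := c') (i := i') (j := j') h half_mem_Ioo
  obtain ⟨h3, h4, rfl⟩ := drawPt_inj ht ht' (h1.symm.trans h2)
  rw [Fin.castLE_inj] at h4
  rw [h4, Nat.succ_injective h3]

theorem layerEdge_not_isDiag (x : Fin 12 × ℕ × Fin 4) : ¬ (layerEdge x).IsDiag := by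
  obtain ⟨c, i, j⟩ := x
  simp only [layerEdge, Sym2.mk_isDiag_iff, nodeShift, Prod.mk.injEq, add_right_inj]
  revert c
  decide

theorem layerGraph_adj {x y : Fin 5 × ℕ × Fin 4} :
    layerGraph.Adj x y ↔ ∃ z, layerEdge z = s(x, y) := by
  rw [layerGraph, fromEdgeSet_adj]
  refine ⟨fun h => h.1, fun h => ⟨h, ?_⟩⟩
  rintro rfl
  obtain ⟨z, hz⟩ := h
  exact layerEdge_not_isDiag z (by rw [hz]; simp)

theorem hasPlanarEmbedding_comap {V : Type*} {f : V → Fin 5 × ℕ × Fin 4}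
    (hf : Function.Injective f) : (layerGraph.comap f).HasPlanarEmbedding := by
  refine ⟨fun v => nodePos (f v),
    fun u v t => (1 - t) • nodePos (f u) + t • nodePos (f v), nodePos_injective.comp hf, ?_, ?_⟩
  · intro u v huv
    have hne : nodePos (f v) - nodePos (f u) ≠ 0 :=
      sub_ne_zero.2 ((nodePos_injective.comp hf).ne huv.ne')
    obtain ⟨⟨c, i, j⟩, h⟩ := layerGraph_adj.1 (comap_adj.1 huv)
    refine ⟨by fun_prop, fun t _ t' _ h => ?_, by simp, by simp, fun t => ?_, fun w t ht hw => ?_⟩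
    · have h' : (t - t') • (nodePos (f v) - nodePos (f u)) = 0 := by
        beta_reduce at h
        have := sub_eq_zero.2 h
        rw [← this]
        module
      rcases smul_eq_zero.1 h' with h' | h'
      · exact sub_eq_zero.1 h'
      · exact absurd h' hne
    · beta_reduce
      rw [sub_sub_cancel, add_comm]
    · obtain ⟨t', ht', h1⟩ := exists_drawPt_of_edge h.symm ht
      obtain ⟨-, h2, -⟩ := drawPt_inj ht' half_mem_Ioo (h1.symm.trans hw)
      have := congrArg Fin.val h2
      simp only [Fin.val_castLE, Fin.val_natAdd] at this
      omega
  · intro u v x y huv hxy hne t₁ ht₁ t₂ ht₂ h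
    obtain ⟨⟨c, i, j⟩, h1⟩ := layerGraph_adj.1 (comap_adj.1 huv)
    obtain ⟨⟨c', i', j'⟩, h2⟩ := layerGraph_adj.1 (comap_adj.1 hxy)
    obtain ⟨t, ht, e1⟩ := exists_drawPt_of_edge h1.symm ht₁
    obtain ⟨t', ht', e2⟩ := exists_drawPt_of_edge h2.symm ht₂
    obtain ⟨h3, h4, rfl⟩ := drawPt_inj ht ht' (e1.symm.trans (h.trans e2))
    rw [Fin.castLE_inj] at h4
    obtain rfl := Nat.succ_injective h3
    rw [h4, h2] at h1
    refine hne (Sym2.map.injective hf ?_)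
    rw [Sym2.map_mk, Sym2.map_mk, h1]

/-- The adjacency relation of the layered graph with levels reduced modulo 3, for a vertex of kind
`t` and a vertex of kind `t'` whose level and rotation differ by `d`. -/
def LayerRel (t t' : Fin 5) (d : ZMod 3 × Fin 4) : Prop :=
  ∃ c, (t = (layerEnds c).1.1 ∧ t' = (layerEnds c).2.1 ∧
      d = (((layerEnds c).2.2.1 : ZMod 3) - ((layerEnds c).1.2.1 : ZMod 3),
        (layerEnds c).2.2.2 - (layerEnds c).1.2.2)) ∨
    (t = (layerEnds c).2.1 ∧ t' = (layerEnds c).1.1 ∧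
      d = (((layerEnds c).1.2.1 : ZMod 3) - ((layerEnds c).2.2.1 : ZMod 3),
        (layerEnds c).1.2.2 - (layerEnds c).2.2.2))

instance (t t' : Fin 5) (d : ZMod 3 × Fin 4) : Decidable (LayerRel t t' d) := by
  unfold LayerRel
  infer_instance

theorem LayerRel.unique_triangle : ∀ (t t' : Fin 5) (d : ZMod 3 × Fin 4), LayerRel t t' d →
    ∀ (t₁ : Fin 5) (d₁ : ZMod 3 × Fin 4), LayerRel t t₁ d₁ → LayerRel t' t₁ (d₁ - d) →
    ∀ (t₂ : Fin 5) (d₂ : ZMod 3 × Fin 4), LayerRel t t₂ d₂ → LayerRel t' t₂ (d₂ - d) →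
      t₁ = t₂ ∧ d₁ = d₂ := by
  decide +kernel

theorem layerRel_of_adj {x y : Fin 5 × ℕ × Fin 4} (h : layerGraph.Adj x y) :
    LayerRel x.1 y.1 ((y.2.1 : ZMod 3) - (x.2.1 : ZMod 3), y.2.2 - x.2.2) ∧
      x.2.1 ≤ y.2.1 + 1 ∧ y.2.1 ≤ x.2.1 + 1 := by
  obtain ⟨⟨c, i, j⟩, h⟩ := layerGraph_adj.1 h
  have hc : ∀ c, (layerEnds c).1.2.1 ≤ (layerEnds c).2.2.1 + 1 ∧
      (layerEnds c).2.2.1 ≤ (layerEnds c).1.2.1 + 1 := by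
    decide
  replace hc := hc c
  rw [layerEdge, Sym2.eq_iff] at h
  rcases h with ⟨rfl, rfl⟩ | ⟨rfl, rfl⟩
  · refine ⟨⟨c, Or.inl ⟨rfl, rfl, ?_⟩⟩, ?_⟩
    · simp [nodeShift]
    · simp only [nodeShift]; omega
  · refine ⟨⟨c, Or.inr ⟨rfl, rfl, ?_⟩⟩, ?_⟩
    · simp [nodeShift]
    · simp only [nodeShift]; omega

theorem layerGraph_unique_triangle {x y z w : Fin 5 × ℕ × Fin 4} (hxy : layerGraph.Adj x y)
    (hxz : layerGraph.Adj x z) (hyz : layerGraph.Adj y z) (hxw : layerGraph.Adj x w)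
    (hyw : layerGraph.Adj y w) : z = w := by
  obtain ⟨h1, -⟩ := layerRel_of_adj hxy
  obtain ⟨h2, h2', h2''⟩ := layerRel_of_adj hxz
  obtain ⟨h3, -⟩ := layerRel_of_adj hyz
  obtain ⟨h4, h4', h4''⟩ := layerRel_of_adj hxw
  obtain ⟨h5, -⟩ := layerRel_of_adj hyw
  obtain ⟨e1, e2⟩ := LayerRel.unique_triangle _ _ _ h1 _ _ h2 (by simpa using h3) _ _ h4
    (by simpa using h5)
  simp only [Prod.mk.injEq, sub_left_inj, ZMod.natCast_eq_natCast_iff'] at e2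
  refine Prod.ext e1 (Prod.ext ?_ e2.2)
  have := e2.1
  omega

theorem not_containsCopy_theta4_comap {V : Type*} {f : V → Fin 5 × ℕ × Fin 4}
    (hf : Function.Injective f) : ¬ ContainsCopy theta4 (layerGraph.comap f) := by
  rintro ⟨g, hg⟩
  have key : ∀ a b, theta4.Adj a b → layerGraph.Adj (f (g a)) (f (g b)) := fun a b h => g.map_adj h
  have h13 := layerGraph_unique_triangle (key 0 2 (by simp [theta4])) (key 0 1 (by simp [theta4]))
    (key 2 1 (by simp [theta4])) (key 0 3 (by simp [theta4])) (key 2 3 (by simp [theta4]))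
  exact absurd (hg (hf h13)) (by decide)

/-- The enumeration of the vertices of the layered graph of positive level, omitting those of kinds
`0` and `1` of level one. -/
def layerNode (m : ℕ) : Fin 5 × ℕ × Fin 4 :=
  (⟨(m + 8) % 20 / 4, by omega⟩, (m + 8) / 20 + 1, ⟨(m + 8) % 4, by omega⟩)

theorem layerNode_injective : Function.Injective layerNode := by
  intro m m' h
  simp only [layerNode, Prod.mk.injEq, Fin.mk.injEq] at h
  omega

theorem exists_layerNode_eq_iff {k : ℕ} {x : Fin 5 × ℕ × Fin 4} :
    (∃ m : Fin (20 * k + 12), layerNode m = x) ↔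
      1 ≤ x.2.1 ∧ x.2.1 ≤ k + 1 ∧ (x.2.1 = 1 → 2 ≤ x.1.1) := by
  obtain ⟨⟨t, ht⟩, l, ⟨j, hj⟩⟩ := x
  simp only [layerNode, Prod.mk.injEq, Fin.mk.injEq]
  constructor
  · rintro ⟨⟨m, hm⟩, h⟩
    dsimp only at h
    omega
  · intro h
    refine ⟨⟨20 * (l - 1) + 4 * t + j - 8, by omega⟩, ?_⟩
    dsimp only
    omega

theorem layerEdge_mem_iff {k : ℕ} (c : Fin 12) (i : ℕ) (j : Fin 4) :
    (∀ x ∈ layerEdge (c, i, j), ∃ m : Fin (20 * k + 12), layerNode m = x) ↔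
      i ≤ k ∧ (i = 0 → c.1 < 6) := by
  simp only [layerEdge, Sym2.mem_iff, forall_eq_or_imp, forall_eq, exists_layerNode_eq_iff]
  fin_cases c <;> simp [layerEnds, nodeShift] <;> omega

theorem ncard_edgeSet_comap_layerNode (k : ℕ) :
    (layerGraph.comap fun m : Fin (20 * k + 12) => layerNode m).edgeSet.ncard = 48 * k + 24 := by
  have hf : Function.Injective fun m : Fin (20 * k + 12) => layerNode m :=
    layerNode_injective.comp Fin.val_injective
  let T : Finset (Fin 12 × ℕ × Fin 4) :=
    (Finset.univ.filter fun c : Fin 12 => c.1 < 6) ×ˢ {0} ×ˢ Finset.univ ∪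
      Finset.univ ×ˢ Finset.Icc 1 k ×ˢ Finset.univ
  have hT : ∀ c i j, (c, i, j) ∈ T ↔ i ≤ k ∧ (i = 0 → c.1 < 6) := by
    intro c i j
    simp only [T, Finset.mem_union, Finset.mem_product, Finset.mem_filter, Finset.mem_univ,
      Finset.mem_singleton, Finset.mem_Icc, true_and, and_true]
    omega
  have hTcard : T.card = 48 * k + 24 := by
    rw [Finset.card_union_of_disjoint]
    · simp only [Finset.card_product, Finset.card_singleton, Finset.card_univ, Fintype.card_fin,
        Nat.card_Icc]
      rw [show (Finset.univ.filter fun c : Fin 12 => c.1 < 6).card = 6 by decide]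
      omega
    · rw [Finset.disjoint_left]
      rintro ⟨c, i, j⟩ h1 h2
      simp only [Finset.mem_product, Finset.mem_singleton, Finset.mem_Icc] at h1 h2
      omega
  have himage : Sym2.map (fun m : Fin (20 * k + 12) => layerNode m) ''
      (layerGraph.comap fun m : Fin (20 * k + 12) => layerNode m).edgeSet =
      layerEdge '' (T : Set (Fin 12 × ℕ × Fin 4)) := by
    ext e
    constructor
    · rintro ⟨e, he, rfl⟩
      induction e using Sym2.ind with
      | _ u v =>
        obtain ⟨⟨c, i, j⟩, h⟩ := layerGraph_adj.1 (comap_adj.1 he)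
        refine ⟨(c, i, j), ?_, h⟩
        rw [Finset.mem_coe, hT, ← layerEdge_mem_iff c i j, h]
        intro x hx
        rcases Sym2.mem_iff.1 hx with rfl | rfl
        · exact ⟨u, rfl⟩
        · exact ⟨v, rfl⟩
    · rintro ⟨⟨c, i, j⟩, hz, rfl⟩
      rw [Finset.mem_coe, hT, ← layerEdge_mem_iff c i j] at hz
      obtain ⟨u, hu⟩ := hz _ (Sym2.mem_mk_left _ _)
      obtain ⟨v, hv⟩ := hz _ (Sym2.mem_mk_right _ _)
      have h : layerEdge (c, i, j) = s(layerNode u, layerNode v) := by rw [hu, hv, layerEdge]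
      exact ⟨s(u, v), comap_adj.2 (layerGraph_adj.2 ⟨_, h⟩), h.symm⟩
  rw [← Set.ncard_image_of_injective _ (Sym2.map.injective hf), himage,
    Set.ncard_image_of_injective _ layerEdge_injective, Set.ncard_coe_finset, hTcard]

end Construction


/-- For every `k ≥ 0` and `n = 20k + 12` there is a planar, `Θ₄`-free simple graph on `n`
vertices with exactly `12(n-2)/5` edges; together with the upper bound this gives
`ex_P(n, Θ₄) = 12(n-2)/5` whenever `n ≡ 12 (mod 20)`. -/
theorem planar_turan_theta4_tight (k n : ℕ) (hn : n = 20 * k + 12) :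
    (∃ G : SimpleGraph (Fin n), G.HasPlanarEmbedding ∧ ¬ ContainsCopy theta4 G ∧
      5 * G.edgeSet.ncard = 12 * (n - 2)) ∧
    (∀ (V : Type) [Fintype V] (G : SimpleGraph V), Fintype.card V = n →
      G.HasPlanarEmbedding → ¬ ContainsCopy theta4 G →
      5 * G.edgeSet.ncard ≤ 12 * (n - 2)) := by 
  subst hn
  refine ⟨⟨layerGraph.comap fun m : Fin (20 * k + 12) => layerNode m, ?_, ?_, ?_⟩, ?_⟩
  · exact hasPlanarEmbedding_comap (layerNode_injective.comp Fin.val_injective)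
  · exact not_containsCopy_theta4_comap (layerNode_injective.comp Fin.val_injective)
  · rw [ncard_edgeSet_comap_layerNode]
    omega
  · intro V _ G hV hG h4
    rw [← hV]
    exact five_mul_ncard_edgeSet_le hG h4 (by omega)
end
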